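/- arXiv:2307.08906 — 2 statements merged into one kernel-verified Lean document; each statement's English description precedes it below -/
import Mathlib

section
/- Let t : ℕ → {0,1} be the Thue–Morse sequence, t(n) = (number of 1's in the binary expansion of n) mod 2, and let u ∈ {0,1}^ℤ be the bilateral word with u_n = t(n) for n ≥ 0 and u_n = t(−n−1) for n < 0. Let X be the closure of the shift-orbit of u in {0,1}^ℤ. Then the Thue–Morse subshift (X, σ) is topologically simple: there exists f ∈ C(X) such that the linear span of {f ∘ σⁿ : n ∈ ℤ} is dense in C(X). -/
/-- The shift by `k ∈ ℤ` on the space `ℤ → A` of bilateral sequences: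
`(σᵏ x) n = x (n + k)`.  For `k = 1` this is the usual left shift `σ`. -/
def shiftZ (A : Type*) [TopologicalSpace A] (k : ℤ) : (ℤ → A) ≃ₜ (ℤ → A) where
  toFun x n := x (n + k)
  invFun x n := x (n - k)
  left_inv x := funext fun n => congrArg x (by ring)
  right_inv x := funext fun n => congrArg x (by ring)
  continuous_toFun := continuous_pi fun n => continuous_apply (n + k)
  continuous_invFun := continuous_pi fun n => continuous_apply (n - k)

/-- The closure of the (bilateral) shift-orbit of a point `u : ℤ → A`. -/
def orbitClosure {A : Type*} [TopologicalSpace A] (u : ℤ → A) : Set (ℤ → A) :=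
  closure {x : ℤ → A | ∃ k : ℤ, x = shiftZ A k u}

/-- The orbit closure of `u` is invariant under every power of the shift. -/
lemma shiftZ_mem_orbitClosure {A : Type*} [TopologicalSpace A] (u : ℤ → A) (k : ℤ)
    {x : ℤ → A} (hx : x ∈ orbitClosure u) : shiftZ A k x ∈ orbitClosure u := by
  refine map_mem_closure (shiftZ A k).continuous hx ?_
  rintro y ⟨m, rfl⟩
  exact ⟨m + k, funext fun n => congrArg u (by ring)⟩

/-- The Thue–Morse sequence: `t n` is the number of `1`s in the binary expansion of `n`,
mod `2`. -/
def thueMorse (n : ℕ) : Fin 2 := ⟨(Nat.digits 2 n).sum % 2, by omega⟩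

/-- The bilateral Thue–Morse word `u`, with `u n = t n` for `n ≥ 0` and `u n = t (-n-1)`
for `n < 0`. -/
def thueMorseBilateral (n : ℤ) : Fin 2 :=
  if 0 ≤ n then thueMorse n.toNat else thueMorse (-n - 1).toNat

namespace TMSimple

/-- Signed Thue–Morse word, with level-dependent sign on the left half. -/
noncomputable def tv (n : ℕ) (k : ℤ) : ℝ :=
  (if thueMorseBilateral k = 0 then 1 else -1) * (if 0 ≤ k then 1 else (-1) ^ n)

lemma tm_even (n : ℕ) : thueMorse (2 * n) = thueMorse n := by
  unfold thueMorse
  rcases Nat.eq_zero_or_pos n with rfl | h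
  · rfl
  · ext
    simp only
    rw [Nat.digits_def' (by norm_num) (by omega)]
    simp

lemma tm_odd (n : ℕ) : thueMorse (2 * n + 1) = 1 - thueMorse n := by
  unfold thueMorse
  have h1 : (Nat.digits 2 (2 * n + 1)).sum = 1 + (Nat.digits 2 n).sum := by
    rw [Nat.digits_def' (by norm_num) (by omega)]
    have : (2 * n + 1) / 2 = n := by omega
    have h2 : (2 * n + 1) % 2 = 1 := by omega
    simp [this, h2]
  simp only [h1]
  rcases Nat.mod_two_eq_zero_or_one (Nat.digits 2 n).sum with h | h
  · have : (1 + (Nat.digits 2 n).sum) % 2 = 1 := by omega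
    simp only [h, this]; rfl
  · have : (1 + (Nat.digits 2 n).sum) % 2 = 0 := by omega
    simp only [h, this]; rfl

lemma sgn_flip (a : Fin 2) : (if 1 - a = 0 then (1 : ℝ) else -1) = -(if a = 0 then 1 else -1) := by
  fin_cases a <;> simp

lemma tv_even (n : ℕ) (k : ℤ) : tv n (2 * k) = tv (n + 1) k := by
  unfold tv thueMorseBilateral
  by_cases h : 0 ≤ k
  · have h2 : 0 ≤ 2 * k := by omega
    have h3 : (2 * k).toNat = 2 * k.toNat := by omega
    simp only [h, h2, if_true, h3, tm_even]
  · have h2 : ¬ 0 ≤ 2 * k := by omega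
    have h3 : (-(2 * k) - 1).toNat = 2 * (-k - 1).toNat + 1 := by omega
    simp only [h, h2, if_false, h3, tm_odd, sgn_flip, pow_succ]
    ring

lemma tv_odd (n : ℕ) (k : ℤ) : tv n (2 * k + 1) = - tv (n + 1) k := by
  unfold tv thueMorseBilateral
  by_cases h : 0 ≤ k
  · have h2 : 0 ≤ 2 * k + 1 := by omega
    have h3 : (2 * k + 1).toNat = 2 * k.toNat + 1 := by omega
    simp only [h, h2, if_true, h3, tm_odd, sgn_flip]
    ring
  · have h2 : ¬ 0 ≤ 2 * k + 1 := by omega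
    have h3 : (-(2 * k + 1) - 1).toNat = 2 * (-k - 1).toNat := by omega
    simp only [h, h2, if_false, h3, tm_even, pow_succ]
    ring

lemma tv_sq (n : ℕ) (k : ℤ) : tv n k = 1 ∨ tv n k = -1 := by
  unfold tv
  rcases neg_one_pow_eq_or ℝ n with h | h <;> rw [h] <;> split_ifs <;> norm_num

lemma tv_mul_self (n : ℕ) (k : ℤ) : tv n k * tv n k = 1 := by
  rcases tv_sq n k with h | h <;> rw [h] <;> norm_num

lemma tv_zero (n : ℕ) : tv n 0 = 1 := by
  unfold tv thueMorseBilateral thueMorse; simp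

lemma tv_one (n : ℕ) : tv n 1 = -1 := by
  have := tv_odd n 0
  rw [tv_zero] at this; simpa using this

lemma tv_two (n : ℕ) : tv n 2 = -1 := by
  have := tv_even n 1
  rw [tv_one] at this; simpa using this

lemma tv8 (n : ℕ) (k : ℤ) : tv n (8 * k) = tv (n+3) k ∧ tv n (8 * k + 1) = -tv (n+3) k ∧
    tv n (8 * k + 2) = -tv (n+3) k ∧ tv n (8 * k + 3) = tv (n+3) k ∧
    tv n (8 * k + 4) = -tv (n+3) k ∧ tv n (8 * k + 5) = tv (n+3) k ∧
    tv n (8 * k + 6) = tv (n+3) k ∧ tv n (8 * k + 7) = -tv (n+3) k := by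
  have e (m : ℕ) (a b : ℤ) (h : a = 2 * b) : tv m a = tv (m+1) b := by rw [h, tv_even]
  have o (m : ℕ) (a b : ℤ) (h : a = 2 * b + 1) : tv m a = - tv (m+1) b := by rw [h, tv_odd]
  refine ⟨?_, ?_, ?_, ?_, ?_, ?_, ?_, ?_⟩
  · rw [e n _ (4*k) (by ring), e _ _ (2*k) (by ring), e _ _ k (by ring)]
  · rw [o n _ (4*k) (by ring), e _ _ (2*k) (by ring), e _ _ k (by ring)]
  · rw [e n _ (4*k+1) (by ring), o _ _ (2*k) (by ring), e _ _ k (by ring)]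
  · rw [o n _ (4*k+1) (by ring), o _ _ (2*k) (by ring), e _ _ k (by ring)]; simp
  · rw [e n _ (4*k+2) (by ring), e _ _ (2*k+1) (by ring), o _ _ k (by ring)]
  · rw [o n _ (4*k+2) (by ring), e _ _ (2*k+1) (by ring), o _ _ k (by ring)]; simp
  · rw [e n _ (4*k+3) (by ring), o _ _ (2*k+1) (by ring), o _ _ k (by ring)]; simp
  · rw [o n _ (4*k+3) (by ring), o _ _ (2*k+1) (by ring), o _ _ k (by ring)]; simp

/-- The key finite inequality on the Thue–Morse word. -/
lemma tv_key (n : ℕ) (j : ℤ) :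
    |tv n j + (1/3) * (tv n (j+1) + tv n (j-1) + tv n (j+2) + tv n (j-2) + tv n (j+4)
      + tv n (j-4) + tv n (j+3))| ≤ 2/3 := by
  obtain ⟨k, i, hi0, hi8, rfl⟩ : ∃ k i : ℤ, 0 ≤ i ∧ i < 8 ∧ j = 8 * k + i :=
    ⟨j / 8, j % 8, by omega, by omega, by omega⟩
  obtain ⟨b0, b1, b2, b3, b4, b5, b6, b7⟩ := tv8 n k
  obtain ⟨a0, a1, a2, a3, a4, a5, a6, a7⟩ := tv8 n (k-1)
  obtain ⟨c0, c1, c2, c3, c4, c5, c6, c7⟩ := tv8 n (k+1)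
  have q (x y : ℤ) (h : x = y) : tv n x = tv n y := by rw [h]
  have hb := tv_sq (n+3) k
  interval_cases i
  · rw [q (8*k+0) (8*k) (by ring), q (8*k+0+1) (8*k+1) (by ring), q (8*k+0-1) (8*(k-1)+7) (by ring),
      q (8*k+0+2) (8*k+2) (by ring), q (8*k+0-2) (8*(k-1)+6) (by ring), q (8*k+0+4) (8*k+4) (by ring),
      q (8*k+0-4) (8*(k-1)+4) (by ring), q (8*k+0+3) (8*k+3) (by ring), b0, b1, a7, b2, a6, b4, a4, b3]
    rcases hb with h | h <;> rcases tv_sq (n+3) (k-1) with h' | h' <;> rw [h, h', abs_le] <;> norm_num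
  · rw [q (8*k+1+1) (8*k+2) (by ring), q (8*k+1-1) (8*k) (by ring),
      q (8*k+1+2) (8*k+3) (by ring), q (8*k+1-2) (8*(k-1)+7) (by ring), q (8*k+1+4) (8*k+5) (by ring),
      q (8*k+1-4) (8*(k-1)+5) (by ring), q (8*k+1+3) (8*k+4) (by ring), b1, b2, b0, b3, a7, b5, a5, b4]
    rcases hb with h | h <;> rcases tv_sq (n+3) (k-1) with h' | h' <;> rw [h, h', abs_le] <;> norm_num
  · rw [q (8*k+2+1) (8*k+3) (by ring), q (8*k+2-1) (8*k+1) (by ring),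
      q (8*k+2+2) (8*k+4) (by ring), q (8*k+2-2) (8*k) (by ring), q (8*k+2+4) (8*k+6) (by ring),
      q (8*k+2-4) (8*(k-1)+6) (by ring), q (8*k+2+3) (8*k+5) (by ring), b2, b3, b1, b4, b0, b6, a6, b5]
    rcases hb with h | h <;> rcases tv_sq (n+3) (k-1) with h' | h' <;> rw [h, h', abs_le] <;> norm_num
  · rw [q (8*k+3+1) (8*k+4) (by ring), q (8*k+3-1) (8*k+2) (by ring),
      q (8*k+3+2) (8*k+5) (by ring), q (8*k+3-2) (8*k+1) (by ring), q (8*k+3+4) (8*k+7) (by ring),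
      q (8*k+3-4) (8*(k-1)+7) (by ring), q (8*k+3+3) (8*k+6) (by ring), b3, b4, b2, b5, b1, b7, a7, b6]
    rcases hb with h | h <;> rcases tv_sq (n+3) (k-1) with h' | h' <;> rw [h, h', abs_le] <;> norm_num
  · rw [q (8*k+4+1) (8*k+5) (by ring), q (8*k+4-1) (8*k+3) (by ring),
      q (8*k+4+2) (8*k+6) (by ring), q (8*k+4-2) (8*k+2) (by ring), q (8*k+4+4) (8*(k+1)) (by ring),
      q (8*k+4-4) (8*k) (by ring), q (8*k+4+3) (8*k+7) (by ring), b4, b5, b3, b6, b2, c0, b0, b7]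
    rcases hb with h | h <;> rcases tv_sq (n+3) (k+1) with h' | h' <;> rw [h, h', abs_le] <;> norm_num
  · rw [q (8*k+5+1) (8*k+6) (by ring), q (8*k+5-1) (8*k+4) (by ring),
      q (8*k+5+2) (8*k+7) (by ring), q (8*k+5-2) (8*k+3) (by ring), q (8*k+5+4) (8*(k+1)+1) (by ring),
      q (8*k+5-4) (8*k+1) (by ring), q (8*k+5+3) (8*(k+1)) (by ring), b5, b6, b4, b7, b3, c1, b1, c0]
    rcases hb with h | h <;> rcases tv_sq (n+3) (k+1) with h' | h' <;> rw [h, h', abs_le] <;> norm_num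
  · rw [q (8*k+6+1) (8*k+7) (by ring), q (8*k+6-1) (8*k+5) (by ring),
      q (8*k+6+2) (8*(k+1)) (by ring), q (8*k+6-2) (8*k+4) (by ring), q (8*k+6+4) (8*(k+1)+2) (by ring),
      q (8*k+6-4) (8*k+2) (by ring), q (8*k+6+3) (8*(k+1)+1) (by ring), b6, b7, b5, c0, b4, c2, b2, c1]
    rcases hb with h | h <;> rcases tv_sq (n+3) (k+1) with h' | h' <;> rw [h, h', abs_le] <;> norm_num
  · rw [q (8*k+7+1) (8*(k+1)) (by ring), q (8*k+7-1) (8*k+6) (by ring),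
      q (8*k+7+2) (8*(k+1)+1) (by ring), q (8*k+7-2) (8*k+5) (by ring), q (8*k+7+4) (8*(k+1)+3) (by ring),
      q (8*k+7-4) (8*k+3) (by ring), q (8*k+7+3) (8*(k+1)+2) (by ring), b7, c0, b6, c1, b5, c3, b3, c2]
    rcases hb with h | h <;> rcases tv_sq (n+3) (k+1) with h' | h' <;> rw [h, h', abs_le] <;> norm_num

/-- The odd basic sequences. -/
noncomputable def so (n : ℕ) (k : ℤ) : ℝ := if (2:ℤ) ^ n ∣ k then tv n (k / 2 ^ n) else 0

lemma so_mul (n : ℕ) (j : ℤ) : so n (2 ^ n * j) = tv n j := by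
  unfold so
  rw [if_pos (dvd_mul_right _ _), Int.mul_ediv_cancel_left _ (by positivity)]

lemma so_of_not (n : ℕ) (k : ℤ) (h : ¬ (2:ℤ) ^ n ∣ k) : so n k = 0 := if_neg h

/-- Case split for the level-`n`, level-`n+1` structure. -/
lemma lvl_cases (n : ℕ) (k : ℤ) :
    (∃ j, k = 2 ^ (n+1) * j) ∨ (∃ j, k = 2 ^ n * (2 * j + 1)) ∨ ¬ (2:ℤ) ^ n ∣ k := by
  by_cases h : (2:ℤ) ^ n ∣ k
  · obtain ⟨m, rfl⟩ := h
    rcases Int.even_or_odd' m with ⟨j, rfl | rfl⟩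
    · exact Or.inl ⟨j, by ring⟩
    · exact Or.inr (Or.inl ⟨j, rfl⟩)
  · exact Or.inr (Or.inr h)

lemma so_even (n : ℕ) (j : ℤ) : so n (2 ^ (n+1) * j) = tv (n+1) j := by
  rw [show (2:ℤ) ^ (n+1) * j = 2 ^ n * (2 * j) by ring, so_mul, tv_even]

lemma so_odd (n : ℕ) (j : ℤ) : so n (2 ^ n * (2 * j + 1)) = - tv (n+1) j := by
  rw [so_mul, tv_odd]

lemma so_succ_odd (n : ℕ) (j : ℤ) : so (n+1) (2 ^ n * (2 * j + 1)) = 0 := by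
  apply so_of_not
  rw [pow_succ]
  intro h
  have := (mul_dvd_mul_iff_left (show (2:ℤ)^n ≠ 0 by positivity)).1 h
  omega

lemma so_succ_not (n : ℕ) (k : ℤ) (h : ¬ (2:ℤ) ^ n ∣ k) : so (n+1) k = 0 :=
  so_of_not _ _ fun h' => h (dvd_trans (pow_dvd_pow _ (by omega)) h')

lemma not_dvd_shift (n : ℕ) (k : ℤ) (h : ¬ (2:ℤ) ^ n ∣ k) (c : ℤ) : ¬ (2:ℤ) ^ n ∣ k + 2 ^ n * c :=
  fun h' => h ((dvd_add_left (dvd_mul_right _ _)).1 h')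

lemma so_rec (n : ℕ) (k : ℤ) : so n k = so (n+1) k - so (n+1) (k + -2 ^ n) := by
  rcases lvl_cases n k with ⟨j, rfl⟩ | ⟨j, rfl⟩ | h
  · rw [so_even, so_mul, show (2:ℤ) ^ (n+1) * j + -2 ^ n = 2 ^ n * (2 * (j-1) + 1) by ring,
      so_succ_odd]; ring
  · rw [so_odd, so_succ_odd, show (2:ℤ) ^ n * (2 * j + 1) + -2 ^ n = 2 ^ (n+1) * j by ring,
      so_mul]; ring
  · rw [so_of_not _ _ h, so_succ_not _ _ h, show -(2:ℤ)^n = 2^n * (-1) by ring,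
      so_succ_not _ _ (not_dvd_shift n k h _)]; ring

/-- (R2) -/
lemma sa_rec (n : ℕ) (k : ℤ) : so n k * so n (k + -2 ^ n) =
    - (so (n+1) k * so (n+1) (k + -2 ^ (n+1))) - so (n+1) (k + 2 ^ n) * so (n+1) (k + 2 ^ n) := by
  rcases lvl_cases n k with ⟨j, rfl⟩ | ⟨j, rfl⟩ | h
  · rw [so_even, so_mul, show (2:ℤ) ^ (n+1) * j + -2 ^ n = 2 ^ n * (2 * (j-1) + 1) by ring,
      show (2:ℤ) ^ (n+1) * j + -2 ^ (n+1) = 2 ^ (n+1) * (j-1) by ring, so_odd, so_mul,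
      show (2:ℤ) ^ (n+1) * j + 2 ^ n = 2 ^ n * (2 * j + 1) by ring, so_succ_odd]; ring
  · rw [so_odd, so_succ_odd, show (2:ℤ) ^ n * (2 * j + 1) + -2 ^ n = 2 ^ (n+1) * j by ring,
      so_even, show (2:ℤ) ^ n * (2 * j + 1) + 2 ^ n = 2 ^ (n+1) * (j + 1) by ring, so_mul,
      tv_mul_self]
    linear_combination - tv_mul_self (n+1) j
  · rw [so_of_not _ _ h, so_succ_not _ _ h, 
      so_succ_not n (k + 2 ^ n) (by simpa using not_dvd_shift n k h 1)]; ring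

/-- (R3) -/
lemma se_rec (n : ℕ) (k : ℤ) : so n k * so n k =
    so (n+1) k * so (n+1) k + so (n+1) (k + 2 ^ n) * so (n+1) (k + 2 ^ n) := by
  rcases lvl_cases n k with ⟨j, rfl⟩ | ⟨j, rfl⟩ | h
  · rw [so_even, so_mul, 
      show (2:ℤ) ^ (n+1) * j + 2 ^ n = 2 ^ n * (2 * j + 1) by ring, so_succ_odd]; ring
  · rw [so_odd, so_succ_odd, show (2:ℤ) ^ n * (2 * j + 1) + 2 ^ n = 2 ^ (n+1) * (j + 1) by ring,
      so_mul, tv_mul_self]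
    linear_combination tv_mul_self (n+1) j
  · rw [so_of_not _ _ h, so_succ_not _ _ h, 
      so_succ_not n (k + 2 ^ n) (by simpa using not_dvd_shift n k h 1)]; ring

/-- (R4) -/
lemma se_per (n : ℕ) (k : ℤ) (c : ℤ) : so n (k + 2 ^ n * c) * so n (k + 2 ^ n * c) =
    so n k * so n k := by
  by_cases h : (2:ℤ) ^ n ∣ k
  · obtain ⟨m, rfl⟩ := h
    rw [← mul_add, so_mul, so_mul, tv_mul_self, tv_mul_self]
  · rw [so_of_not _ _ h, so_of_not _ _ (not_dvd_shift n k h c)]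

lemma so_abs_le (n : ℕ) (k : ℤ) : |so n k| ≤ 1 := by
  by_cases h : (2:ℤ) ^ n ∣ k
  · obtain ⟨m, rfl⟩ := h
    rw [so_mul]; rcases tv_sq n m with h | h <;> rw [h] <;> simp
  · rw [so_of_not _ _ h]; simp

/-- Two-letter window description of `so n` at a higher level. -/
lemma so_block (n d : ℕ) : ∃ c : ℤ → ℝ, ∀ j s : ℤ, 0 ≤ s → s < 2 ^ (n + d) →
    so n (2 ^ (n+d) * j + s) = c s * tv (n+d) j := by
  induction d with
  | zero =>
    refine ⟨fun s => if s = 0 then 1 else 0, fun j s h0 h1 => ?_⟩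
    by_cases hs : s = 0
    · subst hs; simp [so_mul]
    · simp only [hs, if_false, zero_mul, add_zero]
      apply so_of_not
      intro h
      have := (dvd_add_right (dvd_mul_right _ _)).1 h
      exact hs (Int.eq_zero_of_dvd_of_nonneg_of_lt h0 h1 this)
  | succ d ih =>
    obtain ⟨c, hc⟩ := ih
    refine ⟨fun s => if s < 2 ^ (n+d) then c s else - c (s - 2 ^ (n+d)), fun j s h0 h1 => ?_⟩
    have hp : (2:ℤ) ^ (n + (d+1)) = 2 ^ (n+d) * 2 := by rw [← add_assoc, pow_succ]
    by_cases hs : s < 2 ^ (n+d)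
    · simp only [hs, if_true]
      rw [hp, show (2:ℤ) ^ (n+d) * 2 * j + s = 2 ^ (n+d) * (2 * j) + s by ring, hc _ _ h0 hs, tv_even]
      rfl
    · simp only [hs, if_false]
      rw [hp, show (2:ℤ) ^ (n+d) * 2 * j + s = 2 ^ (n+d) * (2 * j + 1) + (s - 2 ^ (n+d)) by ring,
        hc _ _ (by omega) (by omega), tv_odd, ← add_assoc]
      ring

/-- Recognizability identity: the indicator of odd positions at level `n`. -/
lemma so_recog (n : ℕ) (k : ℤ) (p : ℤ → ℝ)
    (hp : ∀ k, p k = (so n k * so n k + so n k * so n (k + 2 ^ n)) / 2) :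
    so (n+1) k = so n k * (1 - (p k + p (k + 2 ^ (n+1)) - p k * p (k + 2 ^ (n+1)))) := by
  rcases lvl_cases n k with ⟨j, rfl⟩ | ⟨j, rfl⟩ | h
  · have h1 : ∀ i : ℤ, p (2 ^ (n+1) * i) = 0 := by
      intro i
      rw [hp, so_even, show (2:ℤ) ^ (n+1) * i + 2 ^ n = 2 ^ n * (2 * i + 1) by ring, so_odd]; ring
    rw [h1, show (2:ℤ) ^ (n+1) * j + 2 ^ (n+1) = 2 ^ (n+1) * (j + 1) by ring, h1, so_mul, so_even]
    ring
  · have h1 : ∀ i : ℤ, p (2 ^ n * (2 * i + 1)) = (1 - tv (n+1) i * tv (n+1) (i+1)) / 2 := by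
      intro i
      rw [hp, so_odd, show (2:ℤ) ^ n * (2 * i + 1) + 2 ^ n = 2 ^ (n+1) * (i+1) by ring, so_even]
      linear_combination (1/2) * tv_mul_self (n+1) i
    rw [h1, show (2:ℤ) ^ n * (2 * j + 1) + 2 ^ (n+1) = 2 ^ n * (2 * (j + 1) + 1) by ring, h1,
      so_succ_odd, so_odd]
    have h3 : ¬ (tv (n+1) j = tv (n+1) (j+1) ∧ tv (n+1) (j+1) = tv (n+1) (j+1+1)) := by
      rintro ⟨h1, h2⟩
      rcases Int.even_or_odd' j with ⟨i, rfl | rfl⟩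
      · rw [tv_even, tv_odd] at h1
        rcases tv_sq (n+1+1) i with h | h <;> rw [h] at h1 <;> norm_num at h1
      · rw [show 2 * i + 1 + 1 = 2 * (i + 1) by ring, tv_even, tv_odd] at h2
        rcases tv_sq (n+1+1) (i+1) with h | h <;> rw [h] at h2 <;> norm_num at h2
    rcases tv_sq (n+1) j with h | h <;> rcases tv_sq (n+1) (j+1) with h' | h' <;>
      rcases tv_sq (n+1) (j+1+1) with hc | hc <;> first | (exfalso; apply h3; rw [h, h', hc]; exact ⟨rfl, rfl⟩) | (rw [h, h', hc]; norm_num)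
  · rw [so_of_not _ _ h, so_succ_not _ _ h]; ring

/-- The Thue–Morse subshift. -/
abbrev XX : Type := ↥(orbitClosure thueMorseBilateral)

instance : CompactSpace XX := isCompact_iff_compactSpace.1 (isClosed_closure.isCompact)

/-- The orbit points. -/
def pt (k : ℤ) : XX := ⟨shiftZ (Fin 2) k thueMorseBilateral, subset_closure ⟨k, rfl⟩⟩

instance : Nonempty XX := ⟨pt 0⟩

/-- The shift on `XX`. -/
def sh (k : ℤ) : C(XX, XX) where
  toFun y := ⟨shiftZ (Fin 2) k y.1, shiftZ_mem_orbitClosure thueMorseBilateral k y.2⟩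
  continuous_toFun := ((shiftZ (Fin 2) k).continuous.comp continuous_subtype_val).subtype_mk _

lemma sh_pt (k j : ℤ) : sh k (pt j) = pt (j + k) := by
  apply Subtype.ext
  funext n
  show thueMorseBilateral (n + k + j) = thueMorseBilateral (n + (j + k))
  congr 1; ring

lemma pt_dense : Dense (Set.range pt) := by
  rw [dense_iff_closure_eq, Set.eq_univ_iff_forall]
  intro x
  rw [closure_subtype]
  have hx : x.1 ∈ closure {x : ℤ → Fin 2 | ∃ k : ℤ, x = shiftZ (Fin 2) k thueMorseBilateral} := x.2
  refine closure_mono ?_ hx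
  rintro y ⟨k, rfl⟩
  exact ⟨pt k, ⟨k, rfl⟩, rfl⟩

lemma ext_pt {f g : C(XX, ℝ)} (h : ∀ k, f (pt k) = g (pt k)) : f = g := by
  apply ContinuousMap.ext
  have := Continuous.ext_on pt_dense f.continuous g.continuous
    (by rintro _ ⟨k, rfl⟩; exact h k)
  exact fun x => congrFun this x

lemma norm_le_pt {f : C(XX, ℝ)} {c : ℝ} (hc : 0 ≤ c) (h : ∀ k, |f (pt k)| ≤ c) : ‖f‖ ≤ c := by
  rw [ContinuousMap.norm_le _ hc]
  intro x
  have hcl : IsClosed {x : XX | ‖f x‖ ≤ c} := isClosed_le (by fun_prop) continuous_const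
  have : closure (Set.range pt) ⊆ {x : XX | ‖f x‖ ≤ c} :=
    hcl.closure_subset_iff.2 (by rintro _ ⟨k, rfl⟩; exact h k)
  exact this (pt_dense x)

lemma abs_pt_le (f : C(XX, ℝ)) (k : ℤ) : |f (pt k)| ≤ ‖f‖ := f.norm_coe_le_norm (pt k)

/-- Koopman operators. -/
noncomputable def T (k : ℤ) : C(XX, ℝ) →L[ℝ] C(XX, ℝ) :=
  ⟨(ContinuousMap.compRightAlgHom ℝ ℝ (sh k)).toLinearMap,
    ContinuousMap.compRightAlgHom_continuous ℝ ℝ (sh k)⟩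

lemma T_apply (k : ℤ) (f : C(XX, ℝ)) (x : XX) : T k f x = f (sh k x) := rfl

@[simp] lemma T_pt (k : ℤ) (f : C(XX, ℝ)) (j : ℤ) : T k f (pt j) = f (pt (j + k)) := by
  rw [T_apply, sh_pt]

lemma T_T (k l : ℤ) (f : C(XX, ℝ)) : T k (T l f) = T (k + l) f :=
  ext_pt fun j => by simp [add_assoc]

@[simp] lemma T_zero (f : C(XX, ℝ)) : T 0 f = f := ext_pt fun j => by simp

lemma T_mul (k : ℤ) (f g : C(XX, ℝ)) : T k (f * g) = T k f * T k g := rfl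

lemma T_norm (k : ℤ) (f : C(XX, ℝ)) : ‖T k f‖ ≤ ‖f‖ :=
  norm_le_pt (norm_nonneg _) fun j => by rw [T_pt]; exact abs_pt_le _ _

/-- The continuous functions realizing the sequences `so n`. -/
lemma exists_O (n : ℕ) : ∃ f : C(XX, ℝ), ∀ k, f (pt k) = so n k := by
  induction n with
  | zero =>
    refine ⟨⟨fun x => if x.1 0 = 0 then 1 else -1, ?_⟩, fun k => ?_⟩
    · have : (fun x : XX => if x.1 0 = 0 then (1:ℝ) else -1) =
        (fun a : Fin 2 => if a = 0 then (1:ℝ) else -1) ∘ (fun x : XX => x.1 0) := rfl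
      rw [this]
      exact (continuous_of_discreteTopology).comp ((continuous_apply 0).comp continuous_subtype_val)
    · show (if thueMorseBilateral (0 + k) = 0 then (1:ℝ) else -1) = _
      simp [so, tv]
  | succ n ih =>
    obtain ⟨f, hf⟩ := ih
    let p : C(XX, ℝ) := (1/2 : ℝ) • (f * f + f * T (2 ^ n) f)
    refine ⟨f * (1 - (p + T (2 ^ (n+1)) p - p * T (2 ^ (n+1)) p)), fun k => ?_⟩
    rw [so_recog n k (fun k => p (pt k))]
    · simp [hf]
    · intro k; simp [p, hf]; ring

/-- odd functions -/
noncomputable def O (n : ℕ) : C(XX, ℝ) := (exists_O n).choose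

@[simp] lemma O_pt (n : ℕ) (k : ℤ) : O n (pt k) = so n k := (exists_O n).choose_spec k

/-- phase indicators -/
noncomputable def Ee (n : ℕ) : C(XX, ℝ) := O n * O n

@[simp] lemma Ee_pt (n : ℕ) (k : ℤ) : Ee n (pt k) = so n k * so n k := by simp [Ee]

/-- products of adjacent letters -/
noncomputable def Aa (n : ℕ) : C(XX, ℝ) := O n * T (-2 ^ n) (O n)

@[simp] lemma Aa_pt (n : ℕ) (k : ℤ) : Aa n (pt k) = so n k * so n (k + -2 ^ n) := by simp [Aa]

lemma O_rec (n : ℕ) : O n = O (n+1) - T (-2 ^ n) (O (n+1)) :=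
  ext_pt fun k => by simpa using so_rec n k

lemma Aa_rec (n : ℕ) : Aa n = - Aa (n+1) - T (2 ^ n) (Ee (n+1)) :=
  ext_pt fun k => by simpa using sa_rec n k

lemma Ee_rec (n : ℕ) : Ee n = Ee (n+1) + T (2 ^ n) (Ee (n+1)) :=
  ext_pt fun k => by simpa using se_rec n k

lemma Ee_per (n : ℕ) (c : ℤ) : T (2 ^ n * c) (Ee n) = Ee n :=
  ext_pt fun k => by simpa using se_per n k c

lemma O_norm (n : ℕ) : ‖O n‖ ≤ 1 := norm_le_pt zero_le_one fun k => by simpa using so_abs_le n k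

/-- bounded sums of odd functions -/
lemma O_sum_self (m K : ℕ) : ‖∑ k ∈ Finset.range K, T (2 ^ m * k) (O m)‖ ≤ 2 := by
  have h : ∑ k ∈ Finset.range K, T (2 ^ m * (k:ℤ)) (O m) =
      T (2 ^ m * ((K : ℤ) - 1)) (O (m+1)) - T (2 ^ m * (0 - 1)) (O (m+1)) := by
    induction K with
    | zero => simp
    | succ K ih =>
      rw [Finset.sum_range_succ, ih]
      conv_lhs => rw [O_rec m, map_sub, T_T]
      rw [show (2:ℤ) ^ m * K + -2 ^ m = 2 ^ m * ((K:ℤ) - 1) by ring]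
      push_cast
      rw [show (2:ℤ) ^ m * ((K : ℤ) + 1 - 1) = 2 ^ m * K by ring]
      abel
  rw [h]
  refine (norm_sub_le _ _).trans ?_
  linarith [T_norm (2 ^ m * ((K : ℤ) - 1)) (O (m+1)), T_norm (2 ^ m * (0 - 1)) (O (m+1)),
    O_norm (m+1)]

lemma O_sum (n d : ℕ) : ∃ C : ℝ, ∀ K : ℕ,
    ‖∑ k ∈ Finset.range K, T (2 ^ (n+d) * k) (O n)‖ ≤ C := by
  induction d generalizing n with
  | zero => exact ⟨2, fun K => O_sum_self n K⟩
  | succ d ih =>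
    obtain ⟨C, hC⟩ := ih (n+1)
    refine ⟨C + C, fun K => ?_⟩
    have hK := hC K
    rw [show n + 1 + d = n + (d + 1) by ring] at hK
    have : ∑ k ∈ Finset.range K, T (2 ^ (n+(d+1)) * (k:ℤ)) (O n) =
      ∑ k ∈ Finset.range K, T (2 ^ (n+(d+1)) * (k:ℤ)) (O (n+1)) -
      T (-2 ^ n) (∑ k ∈ Finset.range K, T (2 ^ (n+(d+1)) * (k:ℤ)) (O (n+1))) := by
      rw [map_sum, ← Finset.sum_sub_distrib]
      refine Finset.sum_congr rfl fun k _ => ?_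
      conv_lhs => rw [O_rec n, map_sub, T_T]
      rw [T_T, add_comm (-2 ^ n)]
    rw [this]
    refine (norm_sub_le _ _).trans (add_le_add hK ((T_norm _ _).trans hK))

lemma sum_range_double {M : Type*} [AddCommMonoid M] (f : ℕ → M) (K : ℕ) :
    ∑ k ∈ Finset.range (2 * K), f k = ∑ k ∈ Finset.range K, (f (2 * k) + f (2 * k + 1)) := by
  induction K with
  | zero => simp
  | succ K ih =>
    rw [show 2 * (K+1) = 2 * K + 1 + 1 by ring, Finset.sum_range_succ, Finset.sum_range_succ, ih,
      Finset.sum_range_succ, add_assoc]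

/-- sums of `Aa` -/
lemma Aa_sum (j m : ℕ) (q : ℤ) :
    |(∑ k ∈ Finset.range (2 ^ j), T (2 ^ m * k) (Aa m)) (pt q) + (2 ^ j / 3) * Ee m (pt q)| ≤
      (4/3) * Ee m (pt q) := by
  induction j generalizing m q with
  | zero =>
    simp only [pow_zero, Finset.range_one, Finset.sum_singleton, Nat.cast_zero, mul_zero, T_zero,
      Aa_pt, Ee_pt]
    by_cases h : (2:ℤ) ^ m ∣ q
    · obtain ⟨i, rfl⟩ := h
      rw [show (2:ℤ) ^ m * i + -2 ^ m = 2 ^ m * (i - 1) by ring, so_mul, so_mul, tv_mul_self]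
      rcases tv_sq m i with h | h <;> rcases tv_sq m (i-1) with h' | h' <;> rw [h, h', abs_le] <;>
        norm_num
    · simp [so_of_not _ _ h]
  | succ j ih =>
    have key : ∑ k ∈ Finset.range (2 ^ (j+1)), T (2 ^ m * (k:ℤ)) (Aa m) =
        - (∑ k ∈ Finset.range (2 ^ j), T (2 ^ (m+1) * (k:ℤ)) (Aa (m+1))) -
        T (2 ^ m) (∑ k ∈ Finset.range (2 ^ j), T (2 ^ (m+1) * (k:ℤ)) (Aa (m+1))) -
        (2 ^ j : ℝ) • Ee m := by
      rw [pow_succ', sum_range_double]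
      have hE : (2 ^ j : ℝ) • Ee m = ∑ k ∈ Finset.range (2 ^ j), Ee m := by
        rw [Finset.sum_const, Finset.card_range, ← Nat.cast_smul_eq_nsmul ℝ]; simp
      rw [hE, map_sum, ← Finset.sum_neg_distrib, ← Finset.sum_sub_distrib, ← Finset.sum_sub_distrib]
      refine Finset.sum_congr rfl fun k _ => ?_
      conv_lhs => rw [Aa_rec m]
      simp only [map_sub, map_neg, T_T]
      push_cast
      rw [show (2:ℤ) ^ m * (2 * k) = 2 ^ (m+1) * k by ring,
        show (2:ℤ) ^ m * (2 * k + 1) = 2 ^ m + 2 ^ (m+1) * k by ring,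
        show (2:ℤ) ^ (m+1) * k + 2 ^ m = 2 ^ m + 2 ^ (m+1) * k by ring,
        show (2:ℤ) ^ m + 2 ^ (m+1) * k + 2 ^ m = 2 ^ (m+1) * (k + 1) by ring, Ee_per,
        ← T_T (2 ^ m) _ (Ee (m+1)), Ee_per, Ee_rec m]
      abel
    have h1 := ih (m+1) q
    have h2 := ih (m+1) (q + 2 ^ m)
    rw [key]
    simp only [ContinuousMap.sub_apply, ContinuousMap.neg_apply, T_pt, ContinuousMap.smul_apply,
      smul_eq_mul]
    have h3 : Ee m (pt q) = Ee (m+1) (pt q) + Ee (m+1) (pt (q + 2 ^ m)) := by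
      conv_lhs => rw [Ee_rec m]
      simp
    rw [h3, pow_succ (2:ℝ) j]
    rw [abs_le] at h1 h2 ⊢
    constructor <;> linarith [h1.1, h1.2, h2.1, h2.2]

lemma mem_of_bdd {Z : Submodule ℝ C(XX, ℝ)} (hZ : IsClosed (Z : Set C(XX, ℝ))) {y : C(XX, ℝ)}
    {C : ℝ} (h : ∀ j : ℕ, ∃ z ∈ Z, ‖(2 ^ j : ℝ) • y - z‖ ≤ C) : y ∈ Z := by
  rw [← SetLike.mem_coe, ← hZ.closure_eq, Metric.mem_closure_iff]
  intro ε hε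
  obtain ⟨j, hj⟩ := pow_unbounded_of_one_lt (C / ε) (one_lt_two (α := ℝ))
  obtain ⟨z, hz, hzC⟩ := h j
  have h2 : (0:ℝ) < 2 ^ j := by positivity
  refine ⟨(2 ^ j : ℝ)⁻¹ • z, Z.smul_mem _ hz, ?_⟩
  have : y - (2 ^ j : ℝ)⁻¹ • z = (2 ^ j : ℝ)⁻¹ • ((2 ^ j : ℝ) • y - z) := by
    rw [smul_sub, smul_smul, inv_mul_cancel₀ h2.ne', one_smul]
  rw [dist_eq_norm, this, norm_smul, norm_inv, Real.norm_of_nonneg h2.le, inv_mul_lt_iff₀ h2]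
  rw [div_lt_iff₀ hε] at hj
  linarith

lemma Ee_norm (n : ℕ) : ‖Ee n‖ ≤ 1 := by
  refine (norm_mul_le _ _).trans ?_
  nlinarith [O_norm n, norm_nonneg (O n)]

/-- distance to a submodule -/
noncomputable def qn (Z : Submodule ℝ C(XX, ℝ)) (g : C(XX, ℝ)) : ℝ :=
  Metric.infDist g (Z : Set C(XX, ℝ))

lemma qn_lt {Z : Submodule ℝ C(XX, ℝ)} {g : C(XX, ℝ)} {r : ℝ} :
    qn Z g < r ↔ ∃ z ∈ Z, ‖g - z‖ < r := by
  unfold qn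
  rw [Metric.infDist_lt_iff ⟨0, Z.zero_mem⟩]
  simp only [dist_eq_norm, SetLike.mem_coe]

lemma qn_le_norm (Z : Submodule ℝ C(XX, ℝ)) (g : C(XX, ℝ)) : qn Z g ≤ ‖g‖ := by
  have := Metric.infDist_le_dist_of_mem (x := g) (s := (Z : Set C(XX, ℝ))) Z.zero_mem
  simpa [qn] using this

lemma qn_nonneg (Z : Submodule ℝ C(XX, ℝ)) (g : C(XX, ℝ)) : 0 ≤ qn Z g := Metric.infDist_nonneg

lemma qn_add_le (Z : Submodule ℝ C(XX, ℝ)) (g g' : C(XX, ℝ)) :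
    qn Z (g + g') ≤ qn Z g + qn Z g' := by
  refine le_of_forall_pos_lt_add fun ε hε => ?_
  obtain ⟨z, hz, h⟩ := qn_lt.1 (show qn Z g < qn Z g + ε / 2 by linarith)
  obtain ⟨z', hz', h'⟩ := qn_lt.1 (show qn Z g' < qn Z g' + ε / 2 by linarith)
  refine qn_lt.2 ⟨z + z', Z.add_mem hz hz', ?_⟩
  rw [show g + g' - (z + z') = (g - z) + (g' - z') by abel]
  linarith [norm_add_le (g - z) (g' - z')]

lemma qn_smul_le (Z : Submodule ℝ C(XX, ℝ)) (c : ℝ) (g : C(XX, ℝ)) :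
    qn Z (c • g) ≤ |c| * qn Z g := by
  by_cases hc : c = 0
  · subst hc
    simpa using qn_le_norm Z 0
  have hc' : 0 < |c| := abs_pos.2 hc
  refine le_of_forall_gt fun r hr => ?_
  obtain ⟨z, hz, h⟩ := qn_lt.1 (show qn Z g < r / |c| by rw [lt_div_iff₀ hc']; linarith)
  refine qn_lt.2 ⟨c • z, Z.smul_mem _ hz, ?_⟩
  rw [← smul_sub, norm_smul, Real.norm_eq_abs]
  rw [lt_div_iff₀ hc'] at h
  linarith

lemma qn_add_mem (Z : Submodule ℝ C(XX, ℝ)) (g : C(XX, ℝ)) {z : C(XX, ℝ)} (hz : z ∈ Z) :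
    qn Z (g + z) ≤ ‖g‖ := by
  unfold qn
  refine (Metric.infDist_le_dist_of_mem (y := z) hz).trans ?_
  rw [dist_eq_norm]; simp

section Zsec

variable {Z : Submodule ℝ C(XX, ℝ)}

lemma Ee_step (hZ : IsClosed (Z : Set C(XX, ℝ))) (hT : ∀ k, ∀ z ∈ Z, T k z ∈ Z)
    (n d : ℕ) (s : ℝ) (hs : s = 1 ∨ s = -1) (h : s • Aa (n+d) + O n ∈ Z) : Ee (n+d+1) ∈ Z := by
  set m := n + d with hm
  obtain ⟨C, hC⟩ := O_sum n (d+1)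
  have hy : s • ((1/3:ℝ) • Ee (m+1) - T (2 ^ m) (Ee (m+1))) ∈ Z := by
    apply mem_of_bdd (C := 4/3 + C) hZ
    intro j
    refine ⟨∑ k ∈ Finset.range (2 ^ j), T (2 ^ (m+1) * (k:ℤ)) (s • Aa m + O n),
      Z.sum_mem fun k _ => hT _ _ h, ?_⟩
    have hE : (2 ^ j : ℝ) • T (2 ^ m) (Ee (m+1)) =
        ∑ k ∈ Finset.range (2 ^ j), T (2 ^ (m+1) * (k:ℤ)) (T (2 ^ m) (Ee (m+1))) := by
      have : ∀ k ∈ Finset.range (2 ^ j), T (2 ^ (m+1) * (k:ℤ)) (T (2 ^ m) (Ee (m+1))) =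
          T (2 ^ m) (Ee (m+1)) := fun k _ => by
        rw [T_T, add_comm, ← T_T, Ee_per]
      rw [Finset.sum_congr rfl this, Finset.sum_const, Finset.card_range,
        ← Nat.cast_smul_eq_nsmul ℝ]; simp
    have e1 : (2 ^ j : ℝ) • (s • ((1/3:ℝ) • Ee (m+1) - T (2 ^ m) (Ee (m+1)))) -
        ∑ k ∈ Finset.range (2 ^ j), T (2 ^ (m+1) * (k:ℤ)) (s • Aa m + O n) =
        s • (∑ k ∈ Finset.range (2 ^ j), T (2 ^ (m+1) * (k:ℤ)) (Aa (m+1)) +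
          (2 ^ j / 3 : ℝ) • Ee (m+1)) -
        ∑ k ∈ Finset.range (2 ^ j), T (2 ^ (m+1) * (k:ℤ)) (O n) := by
      have e2 : ∑ k ∈ Finset.range (2 ^ j), T (2 ^ (m+1) * (k:ℤ)) (s • Aa m + O n) =
          s • (- ∑ k ∈ Finset.range (2 ^ j), T (2 ^ (m+1) * (k:ℤ)) (Aa (m+1)) -
            (2 ^ j : ℝ) • T (2 ^ m) (Ee (m+1))) +
          ∑ k ∈ Finset.range (2 ^ j), T (2 ^ (m+1) * (k:ℤ)) (O n) := by
        rw [hE, ← Finset.sum_neg_distrib, ← Finset.sum_sub_distrib, Finset.smul_sum,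
          ← Finset.sum_add_distrib]
        refine Finset.sum_congr rfl fun k _ => ?_
        rw [Aa_rec m]
        simp only [map_add, map_smul, map_sub, map_neg]
      rw [e2]
      module
    rw [e1]
    refine (norm_sub_le _ _).trans (add_le_add ?_ ?_)
    · rw [norm_smul]
      have : ‖s‖ = 1 := by rcases hs with rfl | rfl <;> simp
      rw [this, one_mul]
      refine norm_le_pt (by norm_num) fun q => ?_
      have h1 := Aa_sum j (m+1) q
      have h2 := (le_abs_self _).trans ((abs_pt_le (Ee (m+1)) q).trans (Ee_norm _))
      rw [ContinuousMap.add_apply, ContinuousMap.smul_apply, smul_eq_mul]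
      linarith
    · have := hC (2 ^ j)
      rw [← add_assoc, ← hm] at this
      exact_mod_cast this
  have hs2 : s * s = 1 := by rcases hs with rfl | rfl <;> norm_num
  have hy1 : (1/3:ℝ) • Ee (m+1) - T (2 ^ m) (Ee (m+1)) ∈ Z := by
    have := Z.smul_mem s hy
    rwa [smul_smul, hs2, one_smul] at this
  have hy2 := hT (2 ^ m) _ hy1
  rw [map_sub, map_smul, T_T, show (2:ℤ) ^ m + 2 ^ m = 2 ^ (m+1) * 1 by ring, Ee_per] at hy2
  have hy3 := Z.sub_mem (Z.smul_mem (-3/8:ℝ) hy1) (Z.smul_mem (9/8:ℝ) hy2)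
  convert hy3 using 1
  module

lemma step_all (hZ : IsClosed (Z : Set C(XX, ℝ))) (hT : ∀ k, ∀ z ∈ Z, T k z ∈ Z)
    (n : ℕ) (h : Aa n + O n ∈ Z) (d : ℕ) :
    ∃ s : ℝ, (s = 1 ∨ s = -1) ∧ s • Aa (n+d) + O n ∈ Z := by
  induction d with
  | zero => exact ⟨1, Or.inl rfl, by simpa using h⟩
  | succ d ih =>
    obtain ⟨s, hs, hz⟩ := ih
    have hE := Ee_step hZ hT n d s hs hz
    refine ⟨-s, by rcases hs with rfl | rfl <;> simp, ?_⟩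
    have := Z.add_mem hz (Z.smul_mem s (hT (2 ^ (n+d)) _ hE))
    rw [Aa_rec] at this
    convert this using 1
    rw [← add_assoc]
    module

lemma Ee_mem (hZ : IsClosed (Z : Set C(XX, ℝ))) (hT : ∀ k, ∀ z ∈ Z, T k z ∈ Z)
    (n : ℕ) (h : Aa n + O n ∈ Z) : Ee n ∈ Z := by
  have hE := Ee_step hZ hT n 0 1 (Or.inl rfl) (by simpa using h)
  rw [Ee_rec]
  exact Z.add_mem hE (hT _ _ hE)

lemma Aa_sparse (m : ℕ) (I : Finset ℤ) (hI : ∀ k ∈ I, ∀ l ∈ I, k ≠ l → ¬ (2:ℤ) ^ m ∣ k - l) :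
    ‖∑ k ∈ I, T k (Aa m)‖ ≤ 1 := by
  refine norm_le_pt zero_le_one fun q => ?_
  rw [ContinuousMap.sum_apply]
  simp only [T_pt, Aa_pt]
  by_cases hq : ∃ k ∈ I, (2:ℤ) ^ m ∣ q + k
  · obtain ⟨k, hk, hd⟩ := hq
    rw [Finset.sum_eq_single_of_mem k hk]
    · rw [abs_mul]
      nlinarith [so_abs_le m (q+k), so_abs_le m (q+k+-2^m), abs_nonneg (so m (q+k)),
        abs_nonneg (so m (q+k+-2^m))]
    · intro l hl hlk
      rw [so_of_not, zero_mul]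
      intro h
      apply hI l hl k hk hlk
      have := dvd_sub h hd
      rwa [show q + l - (q + k) = l - k by ring] at this
  · push Not at hq
    rw [Finset.sum_eq_zero]
    · simp
    · intro k hk
      rw [so_of_not _ _ (hq k hk), zero_mul]

lemma O_sparse (hZ : IsClosed (Z : Set C(XX, ℝ))) (hT : ∀ k, ∀ z ∈ Z, T k z ∈ Z)
    (n : ℕ) (h : Aa n + O n ∈ Z) (I : Finset ℤ) :
    qn Z (∑ k ∈ I, T k (O n)) ≤ 1 := by
  obtain ⟨d, hd⟩ : ∃ d : ℕ, ∀ k ∈ I, |k| < 2 ^ d := by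
    refine ⟨∑ k ∈ I, k.natAbs, fun k hk => ?_⟩
    have h1 : k.natAbs ≤ ∑ k ∈ I, k.natAbs :=
      Finset.single_le_sum (f := fun k : ℤ => k.natAbs) (fun _ _ => Nat.zero_le _) hk
    have h2 := Nat.lt_two_pow_self (n := ∑ k ∈ I, k.natAbs)
    rw [Int.abs_eq_natAbs]
    exact_mod_cast h1.trans_lt h2
  obtain ⟨s, hs, hz⟩ := step_all hZ hT n h (d+1)
  have e : ∑ k ∈ I, T k (O n) = - s • ∑ k ∈ I, T k (Aa (n+(d+1))) +
      ∑ k ∈ I, T k (s • Aa (n+(d+1)) + O n) := by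
    simp only [map_add, map_smul, Finset.sum_add_distrib, Finset.smul_sum, neg_smul,
      Finset.sum_neg_distrib]
    abel
  rw [e]
  refine (qn_add_mem Z _ (Z.sum_mem fun k _ => hT _ _ hz)).trans ?_
  have hs1 : ‖-s‖ = 1 := by rcases hs with rfl | rfl <;> simp
  rw [norm_smul, hs1, one_mul]
  apply Aa_sparse
  intro k hk l hl hkl hdvd
  have h1 := hd k hk
  have h2 := hd l hl
  have h3 : (2:ℤ) ^ (d+1) ∣ k - l := dvd_trans (pow_dvd_pow _ (by omega)) hdvd
  rw [abs_lt] at h1 h2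
  have h4 : |k - l| < 2 ^ (d+1) := by rw [abs_lt, pow_succ]; constructor <;> linarith
  have := Int.eq_zero_of_abs_lt_dvd h3 h4
  omega

/-- odd module at level `n` -/
def OM (n : ℕ) : Submodule ℝ C(XX, ℝ) := Submodule.span ℝ (Set.range fun k => T k (O n))

lemma OM_T (n : ℕ) (k : ℤ) {g : C(XX, ℝ)} (hg : g ∈ OM n) : T k g ∈ OM n := by
  induction hg using Submodule.span_induction with
  | mem x hx =>
    obtain ⟨l, rfl⟩ := hx
    exact Submodule.subset_span ⟨k + l, (T_T _ _ _).symm⟩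
  | zero => simp
  | add x y _ _ hx hy => rw [map_add]; exact Submodule.add_mem _ hx hy
  | smul c x _ hx => rw [map_smul]; exact Submodule.smul_mem _ _ hx

lemma OM_sparse (hZ : IsClosed (Z : Set C(XX, ℝ))) (hT : ∀ k, ∀ z ∈ Z, T k z ∈ Z)
    (n : ℕ) (h : Aa n + O n ∈ Z) {g : C(XX, ℝ)} (hg : g ∈ OM n) : ∃ C : ℝ, ∀ I : Finset ℤ,
    qn Z (∑ k ∈ I, T k g) ≤ C := by
  induction hg using Submodule.span_induction with
  | mem x hx =>
    obtain ⟨l, rfl⟩ := hx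
    refine ⟨1, fun I => ?_⟩
    have := O_sparse hZ hT n h (I.map (addRightEmbedding l))
    rw [Finset.sum_map] at this
    simpa only [T_T, addRightEmbedding_apply] using this
  | zero => exact ⟨0, fun I => by simpa using qn_le_norm Z 0⟩
  | add x y _ _ hx hy =>
    obtain ⟨C, hC⟩ := hx
    obtain ⟨D, hD⟩ := hy
    refine ⟨C + D, fun I => ?_⟩
    simp only [map_add, Finset.sum_add_distrib]
    exact (qn_add_le _ _ _).trans (add_le_add (hC I) (hD I))
  | smul c x _ hx =>
    obtain ⟨C, hC⟩ := hx
    refine ⟨|c| * C, fun I => ?_⟩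
    simp only [map_smul, ← Finset.smul_sum]
    exact (qn_smul_le _ _ _).trans <| mul_le_mul_of_nonneg_left (hC I) (abs_nonneg c)

lemma OM_window (n : ℕ) {g : C(XX, ℝ)} (hg : g ∈ OM n) : ∃ i0 : ℕ, ∀ i, i0 ≤ i → ∃ α β : ℤ → ℝ,
    ∀ j r : ℤ, -2 ^ i ≤ 2 * r → 2 * r < 2 ^ i →
      g (pt (2 ^ i * j + r)) = α r * tv i (j - 1) + β r * tv i j := by
  induction hg using Submodule.span_induction with
  | mem x hx =>
    obtain ⟨l, rfl⟩ := hx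
    refine ⟨n + (l.natAbs + 1), fun i hi => ?_⟩
    obtain ⟨c, hc⟩ := so_block n (i - n)
    rw [show n + (i - n) = i by omega] at hc
    refine ⟨fun r => if 0 ≤ r + l then 0 else c (r + l + 2 ^ i),
      fun r => if 0 ≤ r + l then c (r + l) else 0, fun j r h1 h2 => ?_⟩
    have hl : 2 * |l| ≤ 2 ^ i := by
      have h3 : l.natAbs < 2 ^ l.natAbs := Nat.lt_two_pow_self
      have h4 : 2 ^ (l.natAbs + 1) ≤ 2 ^ i := Nat.pow_le_pow_right (by norm_num) (by omega)
      rw [pow_succ] at h4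
      rw [Int.abs_eq_natAbs]
      have h5 : 2 * l.natAbs ≤ 2 ^ i := by omega
      exact_mod_cast h5
    have hl1 := le_abs_self l
    have hl2 := neg_le_abs l
    simp only [T_pt, O_pt]
    by_cases hs : 0 ≤ r + l
    · simp only [hs, if_true]
      rw [add_assoc, hc _ _ hs (by omega)]; ring
    · simp only [hs, if_false]
      rw [show 2 ^ i * j + r + l = 2 ^ i * (j - 1) + (r + l + 2 ^ i) by ring,
        hc _ _ (by omega) (by omega)]; ring
  | zero => exact ⟨0, fun i _ => ⟨0, 0, fun j r _ _ => by simp⟩⟩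
  | add x y _ _ hx hy =>
    obtain ⟨i0, h0⟩ := hx
    obtain ⟨i1, h1⟩ := hy
    refine ⟨max i0 i1, fun i hi => ?_⟩
    obtain ⟨α, β, h⟩ := h0 i (le_trans (le_max_left _ _) hi)
    obtain ⟨α', β', h'⟩ := h1 i (le_trans (le_max_right _ _) hi)
    refine ⟨α + α', β + β', fun j r hr hr' => ?_⟩
    rw [ContinuousMap.add_apply, h j r hr hr', h' j r hr hr']
    simp only [Pi.add_apply]; ring
  | smul c x _ hx =>
    obtain ⟨i0, h0⟩ := hx
    refine ⟨i0, fun i hi => ?_⟩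
    obtain ⟨α, β, h⟩ := h0 i hi
    refine ⟨c • α, c • β, fun j r hr hr' => ?_⟩
    rw [ContinuousMap.smul_apply, h j r hr hr']
    simp only [Pi.smul_apply, smul_eq_mul]; ring

lemma exists_phase (i : ℕ) (q : ℤ) : ∃ j r : ℤ, q = 2 ^ i * j + r ∧ -2 ^ i ≤ 2 * r ∧
    2 * r < 2 ^ i := by
  have hP : (0:ℤ) < 2 ^ i := by positivity
  generalize (2:ℤ) ^ i = P at hP
  refine ⟨(2 * q + P) / (2 * P), q - P * ((2 * q + P) / (2 * P)), by ring, ?_, ?_⟩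
  · have := Int.mul_ediv_add_emod (2 * q + P) (2 * P)
    have h2 := Int.emod_nonneg (2 * q + P) (b := 2 * P) (by omega)
    nlinarith
  · have := Int.mul_ediv_add_emod (2 * q + P) (2 * P)
    have h2 := Int.emod_lt_of_pos (2 * q + P) (b := 2 * P) (by omega)
    nlinarith

/-- the shifts used in the contraction -/
def BB : Finset ℤ := {1, -1, 2, -2, 4, -4, 3}

lemma sum_BB {M : Type*} [AddCommMonoid M] (f : ℤ → M) : ∑ b ∈ BB, f b =
    f 1 + f (-1) + f 2 + f (-2) + f 4 + f (-4) + f 3 := by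
  unfold BB
  simp only [add_assoc]
  repeat rw [Finset.sum_insert (by decide)]
  rw [Finset.sum_singleton]

lemma OM_contract (n : ℕ) {g : C(XX, ℝ)} (hg : g ∈ OM n) : ∃ i0 : ℕ, ∀ i, i0 ≤ i →
    ‖g + (1/3:ℝ) • ∑ b ∈ BB, T (2 ^ i * b) g‖ ≤ (2/3) * ‖g‖ := by
  obtain ⟨i0, h0⟩ := OM_window n hg
  refine ⟨i0, fun i hi => ?_⟩
  obtain ⟨α, β, h⟩ := h0 i hi
  refine norm_le_pt (by positivity) fun q => ?_
  obtain ⟨j, r, rfl, hr, hr'⟩ := exists_phase i q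
  have hab : |α r| + |β r| ≤ ‖g‖ := by
    have h1 := h 1 r hr hr'
    have h2 := h 2 r hr hr'
    norm_num [tv_zero, tv_one, tv_two] at h1 h2
    have h3 := abs_pt_le g (2 ^ i + r)
    have h4 := abs_pt_le g (2 ^ i * 2 + r)
    rw [h1] at h3
    rw [h2] at h4
    rw [abs_le] at h3 h4
    rcases abs_cases (α r) with ha | ha <;> rcases abs_cases (β r) with hb | hb <;>
      linarith [h3.1, h3.2, h4.1, h4.2]
  have e : (g + (1/3:ℝ) • ∑ b ∈ BB, T (2 ^ i * b) g) (pt (2 ^ i * j + r)) =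
      α r * (tv i (j-1) + (1/3) * ∑ b ∈ BB, tv i (j - 1 + b)) +
      β r * (tv i j + (1/3) * ∑ b ∈ BB, tv i (j + b)) := by
    rw [ContinuousMap.add_apply, ContinuousMap.smul_apply, ContinuousMap.sum_apply, h j r hr hr']
    have : ∀ b ∈ BB, (T (2 ^ i * b) g) (pt (2 ^ i * j + r)) =
        α r * tv i (j - 1 + b) + β r * tv i (j + b) := by
      intro b _
      rw [T_pt, show 2 ^ i * j + r + 2 ^ i * b = 2 ^ i * (j + b) + r by ring, h _ r hr hr',
        show j + b - 1 = j - 1 + b by ring]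
    rw [Finset.sum_congr rfl this, Finset.sum_add_distrib, ← Finset.mul_sum, ← Finset.mul_sum,
      smul_eq_mul]
    ring
  have key : ∀ j, |tv i j + (1/3) * ∑ b ∈ BB, tv i (j + b)| ≤ 2/3 := by
    intro j
    rw [sum_BB]
    exact tv_key i j
  rw [e]
  refine (abs_add_le _ _).trans ?_
  rw [abs_mul, abs_mul]
  nlinarith [mul_le_mul_of_nonneg_left (key j) (abs_nonneg (β r)),
    mul_le_mul_of_nonneg_left (key (j-1)) (abs_nonneg (α r))]

lemma OM_decay (hZ : IsClosed (Z : Set C(XX, ℝ))) (hT : ∀ k, ∀ z ∈ Z, T k z ∈ Z)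
    (n : ℕ) (h : Aa n + O n ∈ Z) (l : ℕ) : ∀ g ∈ OM n,
    qn Z g ≤ (2/3) ^ l * ‖g‖ := by
  induction l with
  | zero => intro g _; simpa using qn_le_norm Z g
  | succ l ih =>
    intro g hg
    obtain ⟨C, hC⟩ := OM_sparse hZ hT n h hg
    obtain ⟨i0, h0⟩ := OM_contract n hg
    have main : ∀ J : ℕ, qn Z g ≤
        (2/3) ^ (l+1) * ‖g‖ + (7 * C / 3) / ((J:ℝ) + 1) := by
      intro J
      have hJ : (0:ℝ) < (J:ℝ) + 1 := by positivity
      set S := ∑ i ∈ Finset.Ico i0 (i0 + (J+1)), ∑ b ∈ BB, T (2 ^ i * b) g with hS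
      set g' := g + (1 / (3 * ((J:ℝ)+1))) • S with hg'
      have hSm : S ∈ OM n := Submodule.sum_mem _ fun i _ => Submodule.sum_mem _ fun b _ => OM_T n _ hg
      have hgm : g' ∈ OM n := Submodule.add_mem _ hg (Submodule.smul_mem _ _ hSm)
      have e1 : g' = (1 / ((J:ℝ)+1)) • ∑ i ∈ Finset.Ico i0 (i0 + (J+1)),
          (g + (1/3:ℝ) • ∑ b ∈ BB, T (2 ^ i * b) g) := by
        rw [Finset.sum_add_distrib, ← Finset.smul_sum, ← hS, Finset.sum_const, Nat.card_Ico,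
          show i0 + (J+1) - i0 = J + 1 by omega, ← Nat.cast_smul_eq_nsmul ℝ, smul_add, smul_smul,
          smul_smul, hg']
        push_cast
        congr 1
        · rw [one_div, inv_mul_cancel₀ hJ.ne', one_smul]
        · congr 1; field_simp
      have n1 : ‖g'‖ ≤ (2/3) * ‖g‖ := by
        rw [e1, norm_smul, Real.norm_of_nonneg (by positivity), one_div, inv_mul_le_iff₀ hJ]
        refine (norm_sum_le_of_le _ (f := fun i => g + (1/3:ℝ) • ∑ b ∈ BB, T (2 ^ i * b) g)
          (n := fun _ => (2/3) * ‖g‖) fun i hi => h0 i (Finset.mem_Ico.1 hi).1).trans ?_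
        rw [Finset.sum_const, Nat.card_Ico, show i0 + (J+1) - i0 = J + 1 by omega, nsmul_eq_mul]
        push_cast
        exact le_rfl
      have n2 : qn Z S ≤ 7 * C := by
        have hb : ∀ b : ℤ, b ≠ 0 → qn Z
            (∑ i ∈ Finset.Ico i0 (i0 + (J+1)), T (2 ^ i * b) g) ≤ C := by
          intro b hb
          have inj : Function.Injective (fun i : ℕ => (2:ℤ) ^ i * b) := by
            intro i i' hii
            have := mul_right_cancel₀ hb hii
            exact Int.pow_right_injective (by norm_num) this
          have := hC ((Finset.Ico i0 (i0 + (J+1))).map ⟨_, inj⟩)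
          rwa [Finset.sum_map] at this
        rw [hS, Finset.sum_comm, sum_BB]
        have b1 := hb 1 (by norm_num)
        have b2 := hb (-1) (by norm_num)
        have b3 := hb 2 (by norm_num)
        have b4 := hb (-2) (by norm_num)
        have b5 := hb 4 (by norm_num)
        have b6 := hb (-4) (by norm_num)
        have b7 := hb 3 (by norm_num)
        refine (qn_add_le _ _ _).trans ?_
        refine (add_le_add_left ((qn_add_le _ _ _).trans (add_le_add_left ((qn_add_le _ _ _).trans
          (add_le_add_left ((qn_add_le _ _ _).trans (add_le_add_left ((qn_add_le _ _ _).trans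
          (add_le_add_left (qn_add_le _ _ _) _)) _)) _)) _)) _).trans ?_
        linarith
      have e2 : g = g' - (1 / (3 * ((J:ℝ)+1))) • S := by rw [hg']; abel
      calc qn Z g
          = qn Z (g' + (-(1 / (3 * ((J:ℝ)+1)))) • S) := by
            rw [neg_smul, ← sub_eq_add_neg, ← e2]
        _ ≤ (2/3) ^ l * ‖g'‖ + (1 / (3 * ((J:ℝ)+1))) * (7 * C) := by
            refine (qn_add_le _ _ _).trans (add_le_add (ih g' hgm) ?_)
            refine (qn_smul_le _ _ _).trans ?_
            rw [abs_neg, abs_of_nonneg (by positivity)]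
            exact mul_le_mul_of_nonneg_left n2 (by positivity)
        _ ≤ (2/3) ^ (l+1) * ‖g‖ + (7 * C / 3) / ((J:ℝ) + 1) := by
            apply add_le_add
            · rw [pow_succ, mul_assoc]
              exact mul_le_mul_of_nonneg_left n1 (by positivity)
            · apply le_of_eq; field_simp
    have lim : Filter.Tendsto (fun J : ℕ => (2/3) ^ (l+1) * ‖g‖ + (7 * C / 3) / ((J:ℝ) + 1))
        Filter.atTop (nhds ((2/3) ^ (l+1) * ‖g‖ + 0)) := by
      apply Filter.Tendsto.const_add
      exact tendsto_const_nhds.div_atTop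
        (Filter.tendsto_atTop_add_const_right _ _ tendsto_natCast_atTop_atTop)
    rw [add_zero] at lim
    exact ge_of_tendsto' lim main

lemma O_mem (hZ : IsClosed (Z : Set C(XX, ℝ))) (hT : ∀ k, ∀ z ∈ Z, T k z ∈ Z)
    (n : ℕ) (h : Aa n + O n ∈ Z) : O n ∈ Z := by
  have hO : O n ∈ OM n := Submodule.subset_span ⟨0, by simp⟩
  have lim : Filter.Tendsto (fun l : ℕ => ((2:ℝ)/3) ^ l * ‖O n‖) Filter.atTop (nhds (0 * ‖O n‖)) :=
    (tendsto_pow_atTop_nhds_zero_of_lt_one (by norm_num) (by norm_num)).mul_const _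
  rw [zero_mul] at lim
  have h0 : qn Z (O n) ≤ 0 :=
    ge_of_tendsto' lim fun l => OM_decay hZ hT n h l _ hO
  have h1 := le_antisymm h0 (qn_nonneg _ _)
  exact (hZ.mem_iff_infDist_zero ⟨0, Z.zero_mem⟩).2 h1

lemma Aa_mem (hZ : IsClosed (Z : Set C(XX, ℝ))) (hT : ∀ k, ∀ z ∈ Z, T k z ∈ Z)
    (n : ℕ) (h : Aa n + O n ∈ Z) : Aa n ∈ Z := by
  have := Z.sub_mem h (O_mem hZ hT n h)
  simpa using this

end Zsec


/-- `f` depends only on the coordinates in `[-W, W]` -/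
def IsLoc (f : C(XX, ℝ)) (W : ℕ) : Prop :=
  ∀ x y : XX, (∀ n : ℤ, |n| ≤ W → x.1 n = y.1 n) → f x = f y

lemma IsLoc.mono {f : C(XX, ℝ)} {W V : ℕ} (h : IsLoc f W) (hWV : W ≤ V) : IsLoc f V :=
  fun x y hxy => h x y fun n hn => hxy n (hn.trans (by exact_mod_cast hWV))

/-- local functions -/
def Loc : Subalgebra ℝ C(XX, ℝ) where
  carrier := {f | ∃ W, IsLoc f W}
  mul_mem' := by
    rintro f g ⟨W, hW⟩ ⟨V, hV⟩
    refine ⟨max W V, fun x y h => ?_⟩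
    rw [ContinuousMap.mul_apply, ContinuousMap.mul_apply, hW.mono (le_max_left _ _) x y h,
      hV.mono (le_max_right _ _) x y h]
  add_mem' := by
    rintro f g ⟨W, hW⟩ ⟨V, hV⟩
    refine ⟨max W V, fun x y h => ?_⟩
    rw [ContinuousMap.add_apply, ContinuousMap.add_apply, hW.mono (le_max_left _ _) x y h,
      hV.mono (le_max_right _ _) x y h]
  algebraMap_mem' := fun r => ⟨0, fun x y _ => rfl⟩

lemma Loc_sep : Loc.SeparatesPoints := by
  intro x y hxy
  have : ∃ n, x.1 n ≠ y.1 n := by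
    by_contra h
    push Not at h
    exact hxy (Subtype.ext (funext h))
  obtain ⟨n, hn⟩ := this
  have hc : Continuous (fun x : XX => if x.1 n = 0 then (1:ℝ) else -1) := by
    have : (fun x : XX => if x.1 n = 0 then (1:ℝ) else -1) =
        (fun a : Fin 2 => if a = 0 then (1:ℝ) else -1) ∘ (fun x : XX => x.1 n) := rfl
    rw [this]
    exact (continuous_of_discreteTopology).comp ((continuous_apply n).comp continuous_subtype_val)
  refine ⟨_, ⟨⟨_, hc⟩, ⟨n.natAbs, fun x y h => ?_⟩, rfl⟩, ?_⟩
  · have := h n (by rw [Int.abs_eq_natAbs])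
    simp [this]
  · simp only [ContinuousMap.coe_mk]
    have h2 : ∀ a b : Fin 2, a ≠ b → (if a = 0 then (1:ℝ) else -1) ≠ if b = 0 then (1:ℝ) else -1 := by
      intro a b hab
      fin_cases a <;> fin_cases b <;> simp at hab ⊢ <;> norm_num
    exact h2 _ _ hn

lemma letter_eq {k l : ℤ} (h : so 0 k = so 0 l) : thueMorseBilateral k = thueMorseBilateral l := by
  have h2 : ∀ a b : Fin 2, (if a = 0 then (1:ℝ) else -1) = (if b = 0 then (1:ℝ) else -1) →
      a = b := by
    intro a b hab
    fin_cases a <;> fin_cases b <;> simp at hab ⊢ <;> norm_num at hab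
  apply h2
  simpa [so, tv] using h

lemma loc_phase {f : C(XX, ℝ)} {W : ℕ} (hf : IsLoc f W) (m : ℕ) (hm : 2 * W ≤ 2 ^ m) (r : ℤ)
    (hr : -2 ^ m ≤ 2 * r) (hr' : 2 * r < 2 ^ m) {j j' : ℤ} (h1 : tv m (j-1) = tv m (j'-1))
    (h2 : tv m j = tv m j') : f (pt (2 ^ m * j + r)) = f (pt (2 ^ m * j' + r)) := by
  obtain ⟨c, hc⟩ := so_block 0 m
  rw [zero_add] at hc
  have hm' : 2 * (W:ℤ) ≤ 2 ^ m := by exact_mod_cast hm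
  apply hf
  intro n hn
  rw [abs_le] at hn
  show thueMorseBilateral (n + (2 ^ m * j + r)) = thueMorseBilateral (n + (2 ^ m * j' + r))
  apply letter_eq
  by_cases hs : 0 ≤ n + r
  · rw [show n + (2 ^ m * j + r) = 2 ^ m * j + (n + r) by ring,
      show n + (2 ^ m * j' + r) = 2 ^ m * j' + (n + r) by ring, hc _ _ hs (by omega),
      hc _ _ hs (by omega), h2]
  · rw [show n + (2 ^ m * j + r) = 2 ^ m * (j - 1) + (n + r + 2 ^ m) by ring,
      show n + (2 ^ m * j' + r) = 2 ^ m * (j' - 1) + (n + r + 2 ^ m) by ring,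
      hc _ _ (by omega) (by omega), hc _ _ (by omega) (by omega), h1]

lemma loc_form {f : C(XX, ℝ)} {W : ℕ} (hf : IsLoc f W) (m : ℕ) (hm : 2 * W ≤ 2 ^ m) (r : ℤ)
    (hr : -2 ^ m ≤ 2 * r) (hr' : 2 * r < 2 ^ m) : ∃ c0 c1 c2 c3 : ℝ, ∀ j : ℤ,
    f (pt (2 ^ m * j + r)) = c0 + c1 * tv m (j-1) + c2 * tv m j + c3 * (tv m j * tv m (j-1)) := by
  let F : ℤ → ℝ := fun j => f (pt (2 ^ m * j + r))
  let p : ℤ → ℝ × ℝ := fun j => (tv m (j-1), tv m j)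
  have hF : F.FactorsThrough p := by
    intro j j' h
    have h := Prod.ext_iff.1 h
    exact loc_phase hf m hm r hr hr' h.1 h.2
  let g := Function.extend p F 0
  have hg : ∀ j, g (tv m (j-1), tv m j) = f (pt (2 ^ m * j + r)) := fun j => hF.extend_apply 0 j
  refine ⟨(g (1,1) + g (1,-1) + g (-1,1) + g (-1,-1)) / 4,
    (g (1,1) + g (1,-1) - g (-1,1) - g (-1,-1)) / 4,
    (g (1,1) - g (1,-1) + g (-1,1) - g (-1,-1)) / 4,
    (g (1,1) - g (1,-1) - g (-1,1) + g (-1,-1)) / 4, fun j => ?_⟩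
  rw [← hg j]
  rcases tv_sq m j with h | h <;> rcases tv_sq m (j-1) with h' | h' <;> rw [h, h'] <;> ring

lemma loc_mem {Z : Submodule ℝ C(XX, ℝ)} (hT : ∀ k, ∀ z ∈ Z, T k z ∈ Z)
    {f : C(XX, ℝ)} {W : ℕ} (hf : IsLoc f W) (m : ℕ) (hm : 2 * W ≤ 2 ^ m)
    (hE : Ee m ∈ Z) (hO : O m ∈ Z) (hA : Aa m ∈ Z) : f ∈ Z := by
  have H : ∀ r : ℤ, ∃ c0 c1 c2 c3 : ℝ, -2 ^ m ≤ 2 * r → 2 * r < 2 ^ m → ∀ j : ℤ,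
    f (pt (2 ^ m * j + r)) = c0 + c1 * tv m (j-1) + c2 * tv m j + c3 * (tv m j * tv m (j-1)) := by
    intro r
    by_cases hr : -2 ^ m ≤ 2 * r ∧ 2 * r < 2 ^ m
    · obtain ⟨c0, c1, c2, c3, h⟩ := loc_form hf m hm r hr.1 hr.2
      exact ⟨c0, c1, c2, c3, fun _ _ => h⟩
    · exact ⟨0, 0, 0, 0, fun h1 h2 => absurd ⟨h1, h2⟩ hr⟩
  choose c0 c1 c2 c3 hc using H
  let G : ℤ → C(XX, ℝ) := fun r =>
    c0 r • Ee m + c1 r • (T (-2 ^ m) (O m) * Ee m) + c2 r • O m + c3 r • Aa m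
  have hEO : T (-2 ^ m) (O m) * Ee m = T (-2 ^ m) (O m) := by
    refine ext_pt fun k => ?_
    rw [ContinuousMap.mul_apply, T_pt, O_pt, Ee_pt]
    by_cases h : (2:ℤ) ^ m ∣ k
    · obtain ⟨i, rfl⟩ := h
      rw [so_mul, tv_mul_self, mul_one]
    · rw [so_of_not m (k + -2 ^ m), zero_mul]
      intro h'
      apply h
      simpa using dvd_add h' (dvd_refl ((2:ℤ) ^ m))
  have hG : ∀ r, G r ∈ Z := fun r =>
    Z.add_mem (Z.add_mem (Z.add_mem (Z.smul_mem _ hE) (Z.smul_mem _ (by rw [hEO]; exact hT _ _ hO)))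
      (Z.smul_mem _ hO)) (Z.smul_mem _ hA)
  have hG0 : ∀ r k, ¬ (2:ℤ) ^ m ∣ k → G r (pt k) = 0 := by
    intro r k hk
    simp [G, so_of_not _ _ hk]
  have hG1 : ∀ r j, G r (pt (2 ^ m * j)) =
      c0 r + c1 r * tv m (j-1) + c2 r * tv m j + c3 r * (tv m j * tv m (j-1)) := by
    intro r j
    have e : (2:ℤ) ^ m * j + -2 ^ m = 2 ^ m * (j - 1) := by ring
    simp [G, e, so_mul, tv_mul_self]
  let R : Finset ℤ := (Finset.Icc (-2 ^ m) (2 ^ m)).filter fun r => -2 ^ m ≤ 2 * r ∧ 2 * r < 2 ^ m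
  have hP : (0:ℤ) < 2 ^ m := by positivity
  have hR : ∀ r, r ∈ R ↔ -2 ^ m ≤ 2 * r ∧ 2 * r < 2 ^ m := by
    intro r
    simp only [R, Finset.mem_filter, Finset.mem_Icc]
    constructor
    · exact fun h => h.2
    · intro h; exact ⟨⟨by omega, by omega⟩, h⟩
  have hfs : f = ∑ r ∈ R, T (-r) (G r) := by
    refine ext_pt fun q => ?_
    obtain ⟨j, r, rfl, hr, hr'⟩ := exists_phase m q
    rw [ContinuousMap.sum_apply, Finset.sum_eq_single_of_mem r ((hR r).2 ⟨hr, hr'⟩)]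
    · rw [T_pt, hc r hr hr', add_neg_cancel_right, hG1]
    · intro s hs hsr
      rw [T_pt]
      apply hG0
      intro hd
      have h3 : (2:ℤ) ^ m ∣ r - s := by
        have := dvd_sub hd (dvd_mul_right ((2:ℤ) ^ m) j)
        rwa [show 2 ^ m * j + r + -s - 2 ^ m * j = r - s by ring] at this
      have hs' := (hR s).1 hs
      have h4 : |r - s| < 2 ^ m := by rw [abs_lt]; constructor <;> omega
      have := Int.eq_zero_of_abs_lt_dvd h3 h4
      omega
  rw [hfs]
  exact Z.sum_mem fun r _ => hT _ _ (hG r)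

/-- the approximating generators -/
lemma dens (f : C(XX, ℝ)) {ε : ℝ} (hε : 0 < ε) : ∃ m0 : ℕ, ∀ m, m0 ≤ m →
    ∀ Z : Submodule ℝ C(XX, ℝ), IsClosed (Z : Set C(XX, ℝ)) → (∀ k, ∀ z ∈ Z, T k z ∈ Z) →
      Aa m + O m ∈ Z → ∃ z ∈ Z, ‖z - f‖ < ε := by
  obtain ⟨⟨g, W, hW⟩, hg⟩ :=
    ContinuousMap.exists_mem_subalgebra_near_continuousMap_of_separatesPoints Loc Loc_sep f ε hε
  refine ⟨2 * W, fun m hm Z hZ hT h => ⟨g, ?_, hg⟩⟩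
  exact loc_mem hT hW m (hm.trans Nat.lt_two_pow_self.le) (Ee_mem hZ hT m h) (O_mem hZ hT m h)
    (Aa_mem hZ hT m h)


/-- shift on sequences -/
def SS : (ℤ → ℂ) →ₗ[ℂ] (ℤ → ℂ) where
  toFun a k := a (k + 1)
  map_add' _ _ := rfl
  map_smul' _ _ := rfl

lemma SS_pow (i : ℕ) (a : ℤ → ℂ) (k : ℤ) : (SS ^ i) a k = a (k + i) := by
  induction i generalizing k with
  | zero => simp
  | succ i ih =>
    rw [pow_succ', Module.End.mul_apply]
    show (SS ^ i) a (k + 1) = _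
    rw [ih]; congr 1; push_cast; ring

lemma geom_bdd {b : ℤ → ℂ} {z : ℂ} (hz : ‖z‖ ≠ 1) {C : ℝ} (hC : ∀ k, ‖b k‖ ≤ C)
    (h : ∀ k, b (k + 1) = z * b k) : b = 0 := by
  have hn : ∀ (n : ℕ) k, b (k + n) = z ^ n * b k := by
    intro n
    induction n with
    | zero => intro k; simp
    | succ n ih =>
      intro k
      rw [show k + ((n + 1 : ℕ) : ℤ) = (k + n) + 1 by push_cast; ring, h, ih]; ring
  funext k
  rw [Pi.zero_apply, ← norm_le_zero_iff]
  rcases lt_or_gt_of_ne hz with hlt | hgt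
  · have lim : Filter.Tendsto (fun n : ℕ => ‖z‖ ^ n * C) Filter.atTop (nhds (0 * C)) :=
      (tendsto_pow_atTop_nhds_zero_of_lt_one (norm_nonneg _) hlt).mul_const _
    rw [zero_mul] at lim
    refine ge_of_tendsto' lim fun n => ?_
    have := hn n (k - n)
    rw [sub_add_cancel] at this
    rw [this, norm_mul, norm_pow]
    exact mul_le_mul_of_nonneg_left (hC _) (by positivity)
  · by_contra hb
    push Not at hb
    obtain ⟨n, hn'⟩ := pow_unbounded_of_one_lt (C / ‖b k‖) hgt
    have h1 := hC (k + n)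
    rw [hn, norm_mul, norm_pow] at h1
    rw [div_lt_iff₀ hb] at hn'
    linarith

lemma prod_bdd (s : Multiset ℂ) (hs : ∀ z ∈ s, ‖z‖ ≠ 1) : ∀ a : ℤ → ℂ, (∃ C : ℝ, ∀ k, ‖a k‖ ≤ C) →
    Polynomial.aeval SS (s.map fun z => Polynomial.X - Polynomial.C z).prod a = 0 → a = 0 := by
  induction s using Multiset.induction_on with
  | empty => intro a _ h; simpa using h
  | cons z s ih =>
    rintro a ⟨C, hC⟩ h
    rw [Multiset.map_cons, Multiset.prod_cons, mul_comm, map_mul, Module.End.mul_apply] at h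
    have e : ∀ k, (Polynomial.aeval SS (Polynomial.X - Polynomial.C z)) a k = a (k + 1) - z * a k := by
      intro k
      rw [map_sub, Polynomial.aeval_X, Polynomial.aeval_C]
      rfl
    have h2 := ih (fun w hw => hs w (Multiset.mem_cons_of_mem hw)) _
      ⟨C + ‖z‖ * C, fun k => by
        rw [e]
        refine (norm_sub_le _ _).trans (add_le_add (hC _) ?_)
        rw [norm_mul]
        exact mul_le_mul_of_nonneg_left (hC _) (norm_nonneg _)⟩ h
    refine geom_bdd (hs z (Multiset.mem_cons_self _ _)) hC fun k => ?_
    have := congrFun h2 k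
    rw [e] at this
    exact sub_eq_zero.1 this

lemma poly_bdd (P : Polynomial ℂ) (hP : P ≠ 0) (hr : ∀ z, P.IsRoot z → ‖z‖ ≠ 1) (a : ℤ → ℂ)
    (hC : ∃ C : ℝ, ∀ k, ‖a k‖ ≤ C)
    (h : ∀ k : ℤ, ∑ i ∈ Finset.range (P.natDegree + 1), P.coeff i * a (k + i) = 0) : a = 0 := by
  apply prod_bdd P.roots (fun z hz => hr z (Polynomial.isRoot_of_mem_roots hz)) a hC
  have h1 : Polynomial.aeval SS P a = 0 := by
    funext k
    rw [Polynomial.aeval_eq_sum_range, LinearMap.sum_apply, Finset.sum_apply]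
    simp only [LinearMap.smul_apply, Pi.smul_apply, SS_pow, smul_eq_mul]
    exact h k
  rw [(IsAlgClosed.splits P).eq_prod_roots, map_mul, Polynomial.aeval_C, Module.End.mul_apply,
    Module.algebraMap_end_apply] at h1
  exact (smul_eq_zero.1 h1).resolve_left (Polynomial.leadingCoeff_ne_zero.2 hP)

/-- cyclic subspace -/
def Sp (f : C(XX, ℝ)) : Submodule ℝ C(XX, ℝ) := Submodule.span ℝ (Set.range fun k => T k f)

lemma Sp_mem (f : C(XX, ℝ)) (k : ℤ) : T k f ∈ Sp f := Submodule.subset_span ⟨k, rfl⟩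

lemma Sp_self (f : C(XX, ℝ)) : f ∈ Sp f := by simpa using Sp_mem f 0

lemma Sp_T (f : C(XX, ℝ)) (k : ℤ) {g : C(XX, ℝ)} (hg : g ∈ Sp f) : T k g ∈ Sp f := by
  induction hg using Submodule.span_induction with
  | mem x hx =>
    obtain ⟨l, rfl⟩ := hx
    exact Submodule.subset_span ⟨k + l, (T_T _ _ _).symm⟩
  | zero => simp
  | add x y _ _ hx hy => rw [map_add]; exact Submodule.add_mem _ hx hy
  | smul c x _ hx => rw [map_smul]; exact Submodule.smul_mem _ _ hx

lemma cl_T (f : C(XX, ℝ)) : ∀ k, ∀ z ∈ (Sp f).topologicalClosure, T k z ∈ (Sp f).topologicalClosure :=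
  fun k _ hz => map_mem_closure (T k).continuous hz fun _ hg => Sp_T f k hg

lemma Sp_op {f g : C(XX, ℝ)} (hg : g ∈ Sp f) : ∃ L : C(XX, ℝ) →L[ℝ] C(XX, ℝ), L f = g ∧
    ∀ f', L f' ∈ Sp f' := by
  induction hg using Submodule.span_induction with
  | mem x hx =>
    obtain ⟨l, rfl⟩ := hx
    exact ⟨T l, rfl, fun f' => Sp_mem f' l⟩
  | zero => exact ⟨0, rfl, fun f' => Submodule.zero_mem _⟩
  | add x y _ _ hx hy =>
    obtain ⟨L, hL, hL'⟩ := hx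
    obtain ⟨M, hM, hM'⟩ := hy
    refine ⟨L + M, ?_, fun f' => Submodule.add_mem _ (hL' f') (hM' f')⟩
    rw [← hL, ← hM]; rfl
  | smul c x _ hx =>
    obtain ⟨L, hL, hL'⟩ := hx
    refine ⟨c • L, ?_, fun f' => Submodule.smul_mem _ _ (hL' f')⟩
    rw [← hL]; rfl

lemma T_pow (n : ℕ) (h : C(XX, ℝ)) : (T 1 ^ n) h = T n h := by
  induction n with
  | zero => simp
  | succ n ih =>
    rw [pow_succ']
    show T 1 ((T 1 ^ n) h) = _
    rw [ih, T_T]; congr 2; push_cast; ring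

/-- polynomial evaluated at the Koopman operator -/
noncomputable def ev (P : Polynomial ℝ) (h : C(XX, ℝ)) : C(XX, ℝ) :=
  ∑ i ∈ Finset.range (P.natDegree + 1), P.coeff i • T i h

lemma ev_eq (P : Polynomial ℝ) (h : C(XX, ℝ)) : ev P h = Polynomial.aeval (T 1) P h := by
  rw [Polynomial.aeval_eq_sum_range, ContinuousLinearMap.sum_apply]
  simp only [ContinuousLinearMap.smul_apply, T_pow]
  rfl

lemma Sp_poly {h g : C(XX, ℝ)} (hg : g ∈ Sp h) : ∃ (N : ℕ) (P : Polynomial ℝ), T N g = ev P h := by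
  simp only [ev_eq]
  have X_ev : ∀ (n : ℕ) (P : Polynomial ℝ), Polynomial.aeval (T 1) (Polynomial.X ^ n * P) h =
      T n (Polynomial.aeval (T 1) P h) := by
    intro n P
    rw [map_mul, map_pow, Polynomial.aeval_X]
    exact T_pow n _
  induction hg using Submodule.span_induction with
  | mem x hx =>
    obtain ⟨l, rfl⟩ := hx
    refine ⟨l.natAbs, Polynomial.X ^ (l.natAbs + l).toNat * 1, ?_⟩
    rw [X_ev, T_T, map_one]
    have : (((l.natAbs + l).toNat : ℕ) : ℤ) = l.natAbs + l := by omega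
    rw [this]; rfl
  | zero => exact ⟨0, 0, by simp⟩
  | add x y _ _ hx hy =>
    obtain ⟨N, P, hP⟩ := hx
    obtain ⟨M, Q, hQ⟩ := hy
    refine ⟨N + M, Polynomial.X ^ M * P + Polynomial.X ^ N * Q, ?_⟩
    rw [map_add, map_add, ContinuousLinearMap.add_apply, X_ev, X_ev, ← hP, ← hQ, T_T, T_T]
    push_cast
    rw [add_comm (M:ℤ)]
  | smul c x _ hx =>
    obtain ⟨N, P, hP⟩ := hx
    refine ⟨N, c • P, ?_⟩
    rw [map_smul, map_smul, ContinuousLinearMap.smul_apply, hP]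

lemma cyc {h f : C(XX, ℝ)} {N : ℤ} {P : Polynomial ℝ} (hf : T N f = ev P h) (hP : P ≠ 0)
    (hr : ∀ z : ℂ, (P.map (algebraMap ℝ ℂ)).IsRoot z → ‖z‖ ≠ 1) : h ∈ (Sp f).topologicalClosure := by
  by_contra hh
  obtain ⟨ν, u, h1, h2⟩ := geometric_hahn_banach_closed_point
    (s := ((Sp f).topologicalClosure : Set C(XX, ℝ))) (Sp f).topologicalClosure.convex
    (Sp f).isClosed_topologicalClosure hh
  have hν : ∀ z ∈ (Sp f).topologicalClosure, ν z = 0 := by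
    intro z hz
    by_contra hne
    have h3 := h1 ((u / ν z) • z) (Submodule.smul_mem _ _ hz)
    rw [map_smul, smul_eq_mul, div_mul_cancel₀ _ hne] at h3
    exact lt_irrefl _ h3
  have hu : 0 < u := by simpa using h1 0 (Submodule.zero_mem _)
  have ha := poly_bdd (P.map (algebraMap ℝ ℂ))
    ((Polynomial.map_ne_zero_iff (algebraMap ℝ ℂ).injective).2 hP) hr
    (fun k => ((ν (T k h) : ℝ) : ℂ)) ⟨‖ν‖ * ‖h‖, fun k => ?_⟩ fun k => ?_
  · have := congrFun ha 0
    simp only [T_zero, Pi.zero_apply, Complex.ofReal_eq_zero] at this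
    linarith
  · rw [Complex.norm_real]
    exact (ν.le_opNorm _).trans (mul_le_mul_of_nonneg_left (T_norm _ _) (norm_nonneg _))
  · have h3 : ν (T k (T N f)) = 0 := hν _ (subset_closure (Sp_T f k (Sp_mem f N)))
    rw [hf, ev, map_sum, map_sum] at h3
    simp only [map_smul, T_T, smul_eq_mul] at h3
    rw [Polynomial.natDegree_map]
    simp only [Polynomial.coeff_map, Complex.coe_algebraMap]
    exact_mod_cast h3

lemma perturb {h f0 : C(XX, ℝ)} (hf0 : f0 ∈ (Sp h).topologicalClosure) {ε : ℝ} (hε : 0 < ε) :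
    ∃ f, ‖f - f0‖ < ε ∧ h ∈ (Sp f).topologicalClosure := by
  obtain ⟨g, hg, hgε⟩ := Metric.mem_closure_iff.1 hf0 (ε / 2) (by linarith)
  rw [dist_comm, dist_eq_norm] at hgε
  obtain ⟨N, P, hP⟩ := Sp_poly hg
  have hgP : g = T (-N) (ev P h) := by rw [← hP, T_T]; simp
  suffices H : ∃ f, ‖f - g‖ < ε / 2 ∧ h ∈ (Sp f).topologicalClosure by
    obtain ⟨f, h1, h2⟩ := H
    refine ⟨f, ?_, h2⟩
    rw [show f - f0 = (f - g) + (g - f0) by abel]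
    linarith [norm_add_le (f - g) (g - f0)]
  by_cases hP0 : P = 0
  · have hg0 : g = 0 := by rw [hgP, hP0]; simp [ev]
    have hn : 0 < 2 * (‖h‖ + 1) := by positivity
    have hη : 0 < ε / (2 * (‖h‖ + 1)) := by positivity
    refine ⟨(ε / (2 * (‖h‖ + 1))) • h, ?_, ?_⟩
    · rw [hg0, sub_zero, norm_smul, Real.norm_of_nonneg hη.le, div_mul_eq_mul_div,
        div_lt_iff₀ hn]
      nlinarith
    · apply subset_closure
      have := (Sp ((ε / (2 * (‖h‖ + 1))) • h)).smul_mem (ε / (2 * (‖h‖ + 1)))⁻¹ (Sp_self _)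
      rwa [smul_smul, inv_mul_cancel₀ hη.ne', one_smul] at this
  let G : ℝ → C(XX, ℝ) := fun c => T (-N) (ev (P.comp (Polynomial.C c * Polynomial.X)) h)
  have hGe : G = fun c => T (-N) (Polynomial.aeval (c • T 1) P h) := by
    funext c
    simp only [G, ev_eq, Polynomial.aeval_comp, map_mul, Polynomial.aeval_C, Polynomial.aeval_X,
      Algebra.algebraMap_eq_smul_one, smul_mul_assoc, one_mul]
  have hGc : Continuous G := by
    rw [hGe]
    simp only [Polynomial.aeval_eq_sum_range, smul_pow, ContinuousLinearMap.sum_apply,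
      ContinuousLinearMap.smul_apply]
    fun_prop
  have hG1 : G 1 = g := by
    rw [hGe, hgP, ev_eq]; simp
  have hev : {c : ℝ | ‖G c - g‖ < ε / 2 ∧ 0 < c} ∈ nhds (1:ℝ) := by
    apply IsOpen.mem_nhds
    · have o1 : IsOpen {c : ℝ | ‖G c - g‖ < ε / 2} :=
        isOpen_lt (hGc.sub continuous_const).norm continuous_const
      exact o1.inter (isOpen_lt continuous_const continuous_id)
    · constructor
      · rw [hG1]; simpa using hε
      · exact one_pos
  have hPm : P.map (algebraMap ℝ ℂ) ≠ 0 :=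
    (Polynomial.map_ne_zero_iff (algebraMap ℝ ℂ).injective).2 hP0
  obtain ⟨c, hc, hcB⟩ := (infinite_of_mem_nhds _ hev).exists_notMem_finset
    ((P.map (algebraMap ℝ ℂ)).roots.toFinset.image norm)
  have hc0 : c ≠ 0 := hc.2.ne'
  refine ⟨G c, hc.1, cyc (N := N) (P := P.comp (Polynomial.C c * Polynomial.X)) ?_ ?_ ?_⟩
  · simp only [G]; rw [T_T]; simp
  · rw [Ne, Polynomial.comp_C_mul_X_eq_zero_iff (by simpa using hc0)]
    exact hP0
  · intro z hz hz1
    apply hcB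
    rw [Finset.mem_image]
    refine ⟨c * z, ?_, ?_⟩
    · rw [Multiset.mem_toFinset, Polynomial.mem_roots hPm]
      rw [Polynomial.IsRoot, Polynomial.map_comp, Polynomial.eval_comp] at hz
      simpa using hz
    · rw [norm_mul, hz1, mul_one, Complex.norm_real, Real.norm_of_nonneg hc.2.le]

lemma trans_dense (f0 g0 : C(XX, ℝ)) {ε δ : ℝ} (hε : 0 < ε) (hδ : 0 < δ) :
    ∃ f, ‖f - f0‖ < ε ∧ ∃ g ∈ Sp f, ‖g - g0‖ < δ := by
  obtain ⟨m0, h0⟩ := dens f0 (half_pos hε)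
  obtain ⟨m1, h1⟩ := dens g0 (half_pos hδ)
  set m := max m0 m1
  set h := Aa m + O m
  obtain ⟨z, hz, hzε⟩ := h0 m (le_max_left _ _) (Sp h).topologicalClosure
    (Sp h).isClosed_topologicalClosure (cl_T h) (subset_closure (Sp_self h))
  obtain ⟨f, hf, hfh⟩ := perturb hz (half_pos hε)
  obtain ⟨w, hw, hwδ⟩ := h1 m (le_max_right _ _) (Sp f).topologicalClosure
    (Sp f).isClosed_topologicalClosure (cl_T f) hfh
  obtain ⟨g, hg, hgδ⟩ := Metric.mem_closure_iff.1 hw (δ / 2) (half_pos hδ)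
  rw [dist_comm, dist_eq_norm] at hgδ
  refine ⟨f, ?_, g, hg, ?_⟩
  · rw [show f - f0 = (f - z) + (z - f0) by abel]
    linarith [norm_add_le (f - z) (z - f0)]
  · rw [show g - g0 = (g - w) + (w - g0) by abel]
    linarith [norm_add_le (g - w) (w - g0)]

lemma exists_cyclic : ∃ f : C(XX, ℝ), Dense (Sp f : Set C(XX, ℝ)) := by
  let d : ℕ → C(XX, ℝ) := TopologicalSpace.denseSeq C(XX, ℝ)
  let D : ℕ × ℕ → Set C(XX, ℝ) := fun p => {f | ∃ g ∈ Sp f, ‖g - d p.1‖ < 1 / ((p.2:ℝ) + 1)}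
  have hD : Dense (⋂ p, D p) := by
    apply dense_iInter_of_isOpen
    · intro p
      rw [isOpen_iff_mem_nhds]
      rintro f ⟨g, hg, hgd⟩
      obtain ⟨L, rfl, hL⟩ := Sp_op hg
      have ho : IsOpen {f' : C(XX, ℝ) | ‖L f' - d p.1‖ < 1 / ((p.2:ℝ) + 1)} :=
        isOpen_lt (by fun_prop) continuous_const
      exact Filter.mem_of_superset (ho.mem_nhds hgd) fun f' hf' => ⟨L f', hL f', hf'⟩
    · intro p
      rw [Metric.dense_iff]
      intro f0 ε hε
      obtain ⟨f, hf, hg⟩ := trans_dense f0 (d p.1) hε (δ := 1 / ((p.2:ℝ) + 1)) (by positivity)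
      exact ⟨f, by rwa [Metric.mem_ball, dist_eq_norm], hg⟩
  obtain ⟨f, hf⟩ := hD.nonempty
  refine ⟨f, ?_⟩
  have hcl : ∀ i, d i ∈ closure (Sp f : Set C(XX, ℝ)) := by
    intro i
    rw [Metric.mem_closure_iff]
    intro ε hε
    obtain ⟨n, hn⟩ := exists_nat_one_div_lt hε
    obtain ⟨g, hg, hgd⟩ := Set.mem_iInter.1 hf (i, n)
    exact ⟨g, hg, by rw [dist_comm, dist_eq_norm]; exact hgd.trans hn⟩
  have : closure (Set.range d) ⊆ closure (Sp f : Set C(XX, ℝ)) :=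
    closure_minimal (by rintro _ ⟨i, rfl⟩; exact hcl i) isClosed_closure
  exact fun x => this (TopologicalSpace.denseRange_denseSeq _ x)

end TMSimple

/-- **The Thue–Morse subshift is topologically simple.**  Let `X` be the closure of the
shift-orbit of the bilateral Thue–Morse word `u`.  Then there exists `f ∈ C(X)` whose
iterates `f ∘ σⁿ`, `n ∈ ℤ`, span a dense subspace of `C(X)`. -/
theorem thueMorse_topologically_simple :
    ∃ f : C(↥(orbitClosure thueMorseBilateral), ℝ),
      Dense (Submodule.span ℝ
        {h : C(↥(orbitClosure thueMorseBilateral), ℝ) | ∃ n : ℤ,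
          ∀ y : ↥(orbitClosure thueMorseBilateral),
            h y = f ⟨shiftZ (Fin 2) n y.1, shiftZ_mem_orbitClosure thueMorseBilateral n y.2⟩} :
        Set C(↥(orbitClosure thueMorseBilateral), ℝ)) := by
  obtain ⟨f, hf⟩ := TMSimple.exists_cyclic
  refine ⟨f, hf.mono ?_⟩
  unfold TMSimple.Sp
  apply Submodule.span_mono
  rintro _ ⟨k, rfl⟩
  exact ⟨k, fun y => rfl⟩
end

section
/- Let k ≥ 1 and let V be the operator on the complex Banach space (C₀(ℝ,ℂ))^k (k-fold product of the space of continuous complex-valued functions on ℝ vanishing at infinity, with the supremum norm) defined by V((f_i)_{1≤i≤k}) = (f_i(· + 1))_{1≤i≤k}. Then V is cyclic: there exists g ∈ (C₀(ℝ,ℂ))^k such that the complex linear span of {Vⁿ g : n ∈ ℤ} is dense in (C₀(ℝ,ℂ))^k. The same holds for the corresponding translation operator on (C₀(ℝ,ℝ))^k over ℝ. -/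
open ZeroAtInfty


set_option linter.unusedSectionVars false

section Abstract
variable {𝕜 X : Type*} [RCLike 𝕜] [NormedAddCommGroup X] [NormedSpace 𝕜 X] [CompleteSpace X]

/-- finite sums along sparse translates are controlled by the sup of coefficients -/
def LocSmall (τ : ℤ → X →L[𝕜] X) (f : X) : Prop :=
  ∃ M0 : ℤ, ∀ M ≥ M0, ∀ (s : Finset ℤ) (a : ℤ → 𝕜) (c : ℝ), 0 ≤ c → (∀ n, ‖a n‖ ≤ c) →
    ‖∑ n ∈ s, a n • τ (M * n) f‖ ≤ c * ‖f‖

theorem summable_tau (τ : ℤ → X →L[𝕜] X) (hn : ∀ n x, ‖τ n x‖ ≤ ‖x‖)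
    (q : ℤ → 𝕜) (hq : Summable fun n => ‖q n‖) (M : ℤ) (f : X) :
    Summable fun n => q n • τ (M * n) f := by
  refine Summable.of_norm_bounded (g := fun n => ‖q n‖ * ‖f‖) (hq.mul_right _) fun n => ?_
  rw [norm_smul]
  exact mul_le_mul_of_nonneg_left (hn _ _) (norm_nonneg _)

theorem tsum_tau_le (τ : ℤ → X →L[𝕜] X) (hn : ∀ n x, ‖τ n x‖ ≤ ‖x‖)
    (q : ℤ → 𝕜) (hq : Summable fun n => ‖q n‖) (M : ℤ) (f : X) :
    ‖∑' n, q n • τ (M * n) f‖ ≤ (∑' n, ‖q n‖) * ‖f‖ := by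
  refine tsum_of_norm_bounded (g := fun n => ‖q n‖ * ‖f‖) (hq.hasSum.mul_right _) fun n => ?_
  rw [norm_smul]
  exact mul_le_mul_of_nonneg_left (hn _ _) (norm_nonneg _)

theorem approx_tau (τ : ℤ → X →L[𝕜] X) (hn : ∀ n x, ‖τ n x‖ ≤ ‖x‖)
    (hD : Dense {f | LocSmall τ f})
    (q : ℤ → 𝕜) (hq : Summable fun n => ‖q n‖) (c : ℝ) (hc : 0 ≤ c) (hqc : ∀ n, ‖q n‖ ≤ c)
    (δ : ℝ) (hδ : 0 < δ) (f : X) :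
    ∃ M0 : ℤ, ∀ M ≥ M0, ‖∑' n, q n • τ (M * n) f‖ ≤ c * ‖f‖ + δ := by
  set Q := ∑' n, ‖q n‖ with hQ
  have hQ0 : 0 ≤ Q := tsum_nonneg fun _ => norm_nonneg _
  obtain ⟨f0, hf0, hd⟩ := hD.exists_dist_lt f (ε := δ / (Q + c + 1)) (by positivity)
  obtain ⟨M0, hM0⟩ := hf0
  refine ⟨M0, fun M hM => ?_⟩
  have e : ∑' n, q n • τ (M * n) f
      = ∑' n, q n • τ (M * n) f0 + ∑' n, q n • τ (M * n) (f - f0) := by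
    rw [← (summable_tau τ hn q hq M f0).tsum_add (summable_tau τ hn q hq M (f - f0))]
    congr 1; ext n
    rw [map_sub, smul_sub]; abel
  have h1 : ‖∑' n, q n • τ (M * n) f0‖ ≤ c * ‖f0‖ := by
    have := (summable_tau τ hn q hq M f0).hasSum.norm
    exact le_of_tendsto this (Filter.Eventually.of_forall fun s => hM0 M hM s q c hc hqc)
  have h2 := tsum_tau_le τ hn q hq M (f - f0)
  rw [dist_eq_norm] at hd
  have h3 : ‖f0‖ ≤ ‖f‖ + ‖f - f0‖ := by
    have := norm_sub_norm_le f0 f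
    rw [norm_sub_rev] at this; linarith
  have h4 : (Q + c + 1) * ‖f - f0‖ ≤ δ := by
    have := (lt_div_iff₀ (by positivity : 0 < Q + c + 1)).1 hd
    linarith
  rw [e]
  refine (norm_add_le _ _).trans ?_
  have h5 : c * ‖f0‖ ≤ c * (‖f‖ + ‖f - f0‖) := mul_le_mul_of_nonneg_left h3 hc
  nlinarith [norm_nonneg (f - f0)]

/-- coefficients of the inverse of `(z^2 + 3/2 z - 1)/2` -/
noncomputable def qinv (n : ℤ) : ℝ :=
  if n < 0 then (8 / 5) * (2 : ℝ) ^ n else -(2 / 5) * (-1 / 2 : ℝ) ^ n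

/-- coefficients of `(z^2 + 3/2 z - 1)/2` -/
noncomputable def qpol (n : ℤ) : ℝ :=
  if n = 0 then -1 / 2 else if n = 1 then 3 / 4 else if n = 2 then 1 / 2 else 0

theorem qpol_bound (n : ℤ) : |qpol n| ≤ 4 / 5 := by
  unfold qpol; split_ifs <;> norm_num [abs_le]

theorem qinv_bound (n : ℤ) : |qinv n| ≤ 4 / 5 := by
  unfold qinv; split_ifs with h
  · rw [abs_of_nonneg (by positivity)]
    have : (2 : ℝ) ^ n ≤ 2 ^ (-1 : ℤ) := zpow_le_zpow_right₀ (by norm_num) (by omega)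
    norm_num at this ⊢; linarith
  · push Not at h
    lift n to ℕ using h
    rw [zpow_natCast, abs_mul, abs_pow]
    have : |(-1 / 2 : ℝ)| ^ n ≤ 1 := pow_le_one₀ (abs_nonneg _) (by norm_num [abs_le])
    norm_num [abs_of_nonneg, abs_of_neg] at this ⊢; linarith

theorem qinv_summable : Summable fun n => |qinv n| := by
  rw [summable_int_iff_summable_nat_and_neg]
  have hg : Summable fun n : ℕ => (8 / 5) * (1 / 2 : ℝ) ^ n :=
    (summable_geometric_of_lt_one (by norm_num) (by norm_num)).mul_left _
  constructor
  · refine Summable.of_nonneg_of_le (fun _ => abs_nonneg _) (fun n => ?_) hg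
    have : ¬ ((n : ℤ) < 0) := by omega
    simp only [qinv, this, if_false, zpow_natCast, abs_mul, abs_pow]
    norm_num [abs_of_neg, abs_of_pos]
  · refine Summable.of_nonneg_of_le (fun _ => abs_nonneg _) (fun n => ?_) hg
    rcases Nat.eq_zero_or_pos n with rfl | h
    · norm_num [qinv, abs_of_neg]
    have : (-(n : ℤ) < 0) := by omega
    simp only [qinv, this, if_true]
    rw [abs_of_nonneg (by positivity)]
    simp

theorem qinv_neg {n : ℤ} (h : n < 0) : qinv n = (8 / 5) * (2 : ℝ) ^ n := if_pos h

theorem qinv_nonneg {n : ℤ} (h : 0 ≤ n) : qinv n = -(2 / 5) * (-1 / 2 : ℝ) ^ n :=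
  if_neg (not_lt.2 h)

theorem qinv_rec (n : ℤ) : (1 / 2) * qinv (n - 2) + (3 / 4) * qinv (n - 1) - (1 / 2) * qinv n
    = if n = 0 then 1 else 0 := by
  rcases lt_trichotomy n 0 with h | h | h
  · rw [if_neg h.ne, qinv_neg h, qinv_neg (by omega), qinv_neg (by omega),
      zpow_sub₀ (by norm_num), zpow_sub₀ (by norm_num)]
    rw [zpow_ofNat, zpow_one]; ring
  · rw [if_pos h, qinv_nonneg h.ge, qinv_neg (by omega), qinv_neg (by omega), h]
    have e1 : (2 : ℝ) ^ (0 - 2 : ℤ) = 1 / 4 := by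
      rw [show (0 - 2 : ℤ) = -((2 : ℕ) : ℤ) by rfl, zpow_neg, zpow_natCast]; norm_num
    have e2 : (2 : ℝ) ^ (0 - 1 : ℤ) = 1 / 2 := by
      rw [show (0 - 1 : ℤ) = -((1 : ℕ) : ℤ) by rfl, zpow_neg, zpow_natCast]; norm_num
    rw [e1, e2, zpow_zero]; norm_num
  · rw [if_neg h.ne']
    rcases eq_or_lt_of_le (show 1 ≤ n by omega) with h1 | h2
    · rw [← h1, qinv_neg (by norm_num), qinv_nonneg (by norm_num), qinv_nonneg (by norm_num)]
      have e1 : (2 : ℝ) ^ (1 - 2 : ℤ) = 1 / 2 := by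
        rw [show (1 - 2 : ℤ) = -((1 : ℕ) : ℤ) by rfl, zpow_neg, zpow_natCast]; norm_num
      rw [e1, sub_self, zpow_zero, zpow_one]; norm_num
    · rw [qinv_nonneg h.le, qinv_nonneg (by omega), qinv_nonneg (by omega),
        zpow_sub₀ (by norm_num), zpow_sub₀ (by norm_num)]
      rw [zpow_ofNat, zpow_one]; ring

/-- The step polynomial. -/
noncomputable def Pol (τ : ℤ → X →L[𝕜] X) (M : ℤ) : X →L[𝕜] X :=
  ((1 / 2 : ℝ) : 𝕜) • τ (M * 2) + ((3 / 4 : ℝ) : 𝕜) • τ (M * 1) + ((-1 / 2 : ℝ) : 𝕜) • τ (M * 0)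

theorem Pol_eq (τ : ℤ → X →L[𝕜] X) (M : ℤ) (f : X) :
    Pol τ M f = ∑' n, ((qpol n : ℝ) : 𝕜) • τ (M * n) f := by
  rw [tsum_eq_sum (s := ({0, 1, 2} : Finset ℤ))]
  · simp [Pol, qpol]; abel
  · intro n hn
    simp at hn
    simp [qpol, hn]

theorem Pol_inv (τ : ℤ → X →L[𝕜] X) (h0 : ∀ x, τ 0 x = x)
    (hadd : ∀ m n x, τ (m + n) x = τ m (τ n x)) (hn : ∀ n x, ‖τ n x‖ ≤ ‖x‖) (M : ℤ) (w : X) :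
    Pol τ M (∑' n, ((qinv n : ℝ) : 𝕜) • τ (M * n) w) = w := by
  have hs : Summable fun n => ‖((qinv n : ℝ) : 𝕜)‖ := by simpa using qinv_summable
  have hS := (summable_tau τ hn _ hs M w).hasSum
  set η := ∑' n, ((qinv n : ℝ) : 𝕜) • τ (M * n) w
  have key : ∀ j : ℤ, HasSum (fun n => ((qinv (n - j) : ℝ) : 𝕜) • τ (M * n) w) (τ (M * j) η) := by
    intro j
    have h1 := (τ (M * j)).hasSum hS
    rw [← (Equiv.addRight j).hasSum_iff]
    convert h1 using 1
    ext n
    simp [mul_add, ← hadd, add_comm]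
  have h3 := (((key 2).const_smul ((1 / 2 : ℝ) : 𝕜)).add
    ((key 1).const_smul ((3 / 4 : ℝ) : 𝕜))).add ((key 0).const_smul ((-1 / 2 : ℝ) : 𝕜))
  have h4 : HasSum (fun n : ℤ => (((if n = 0 then 1 else 0 : ℝ) : ℝ) : 𝕜) • τ (M * n) w) w := by
    convert hasSum_single (0 : ℤ) _ using 1
    · simp [h0]
    · intro n hn; simp [hn]
  refine HasSum.unique (f := fun n : ℤ => (((if n = 0 then 1 else 0 : ℝ) : ℝ) : 𝕜) • τ (M * n) w)
    ?_ h4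
  change HasSum _ (((1 / 2 : ℝ) : 𝕜) • τ (M * 2) η + ((3 / 4 : ℝ) : 𝕜) • τ (M * 1) η
    + ((-1 / 2 : ℝ) : 𝕜) • τ (M * 0) η)
  convert h3 using 1
  ext n
  rw [← qinv_rec, smul_smul, smul_smul, smul_smul, ← add_smul, ← add_smul]
  congr 1
  push_cast
  simp
  ring

/-- span of an orbit -/
def cyc (τ : ℤ → X →L[𝕜] X) (g : X) : Submodule 𝕜 X :=
  Submodule.span 𝕜 (Set.range fun n => τ n g)

theorem cyc_inv (τ : ℤ → X →L[𝕜] X) (hadd : ∀ m n x, τ (m + n) x = τ m (τ n x)) (g : X) (n : ℤ)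
    {x : X} (hx : x ∈ cyc τ g) : τ n x ∈ cyc τ g := by
  have : cyc τ g ≤ (cyc τ g).comap (τ n : X →ₗ[𝕜] X) := by
    refine Submodule.span_le.2 ?_
    rintro _ ⟨m, rfl⟩
    exact Submodule.subset_span ⟨n + m, hadd _ _ _⟩
  exact this hx

theorem Pol_mem (τ : ℤ → X →L[𝕜] X) (hadd : ∀ m n x, τ (m + n) x = τ m (τ n x)) (g : X) (M : ℤ)
    {x : X} (hx : x ∈ cyc τ g) : Pol τ M x ∈ cyc τ g := by
  simp only [Pol, add_apply, smul_apply]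
  refine add_mem (add_mem ?_ ?_) ?_ <;> exact Submodule.smul_mem _ _ (cyc_inv τ hadd _ _ hx)

theorem Pol_comm (τ : ℤ → X →L[𝕜] X) (p : X →L[𝕜] X) (hp : ∀ n x, p (τ n x) = τ n (p x)) (M : ℤ)
    (x : X) : p (Pol τ M x) = Pol τ M (p x) := by
  simp [Pol, hp]

theorem step (τ : ℤ → X →L[𝕜] X) (h0 : ∀ x, τ 0 x = x)
    (hadd : ∀ m n x, τ (m + n) x = τ m (τ n x)) (hn : ∀ n x, ‖τ n x‖ ≤ ‖x‖)
    (hD : Dense {f | LocSmall τ f}) (α : ℝ) (hα : 0 < α) (u w : X) (hu : ‖u‖ ≤ α) (hw : ‖w‖ ≤ α) :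
    ∃ (M : ℤ) (η : X), ‖Pol τ M u‖ ≤ 9 / 10 * α ∧ ‖η‖ ≤ 9 / 10 * α ∧ Pol τ M η = w := by
  have hp : Summable fun n => ‖((qpol n : ℝ) : 𝕜)‖ := by
    refine summable_of_ne_finset_zero (s := ({0, 1, 2} : Finset ℤ)) ?_
    intro n hn
    simp at hn
    simp [qpol, hn]
  have hs : Summable fun n => ‖((qinv n : ℝ) : 𝕜)‖ := by simpa using qinv_summable
  obtain ⟨M1, h1⟩ := approx_tau τ hn hD _ hp (4 / 5) (by norm_num)
    (fun n => by simpa using qpol_bound n) (α / 10) (by positivity) u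
  obtain ⟨M2, h2⟩ := approx_tau τ hn hD _ hs (4 / 5) (by norm_num)
    (fun n => by simpa using qinv_bound n) (α / 10) (by positivity) w
  refine ⟨max M1 M2, _, ?_, ?_, Pol_inv τ h0 hadd hn (max M1 M2) w⟩
  · rw [Pol_eq]
    linarith [h1 _ (le_max_left M1 M2)]
  · linarith [h2 _ (le_max_right M1 M2)]

theorem iter (τ : ℤ → X →L[𝕜] X) (h0 : ∀ x, τ 0 x = x)
    (hadd : ∀ m n x, τ (m + n) x = τ m (τ n x)) (hn : ∀ n x, ‖τ n x‖ ≤ ‖x‖)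
    (hD : Dense {f | LocSmall τ f}) (α : ℝ) (hα : 0 < α) (u w : X) (hu : ‖u‖ ≤ α) (hw : ‖w‖ ≤ α)
    (m : ℕ) :
    ∃ (p : X →L[𝕜] X) (η : X), (∀ n x, p (τ n x) = τ n (p x)) ∧ (∀ x, p x ∈ cyc τ x) ∧
      ‖p u‖ ≤ (9 / 10) ^ m * α ∧ ‖η‖ ≤ (9 / 10) ^ m * α ∧ p η = w := by
  induction m with
  | zero =>
    refine ⟨ContinuousLinearMap.id 𝕜 X, w, by simp, fun x => ?_, by simpa, by simpa, by simp⟩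
    exact Submodule.subset_span ⟨0, h0 x⟩
  | succ m ih =>
    obtain ⟨p, η, hc, hm, hpu, hη, hw'⟩ := ih
    obtain ⟨M, η', a1, a2, a3⟩ := step τ h0 hadd hn hD _ (by positivity) (p u) η hpu hη
    refine ⟨(Pol τ M).comp p, η', ?_, ?_, ?_, ?_, ?_⟩
    · intro n x
      have : ∀ a b x, τ a (τ b x) = τ b (τ a x) := fun a b x => by
        rw [← hadd, ← hadd, add_comm]
      simp only [ContinuousLinearMap.comp_apply, hc]
      rw [Pol_comm τ (τ n) (fun a x => this n a x)]
    · intro x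
      exact Pol_mem τ hadd _ _ (hm x)
    · rw [pow_succ']; simpa [mul_assoc] using a1
    · rw [pow_succ']; simpa [mul_assoc] using a2
    · rw [ContinuousLinearMap.comp_apply, ← Pol_comm τ p hc, a3, hw']

theorem exists_cyclic [TopologicalSpace.SeparableSpace X] (τ : ℤ → X →L[𝕜] X) (h0 : ∀ x, τ 0 x = x)
    (hadd : ∀ m n x, τ (m + n) x = τ m (τ n x)) (hn : ∀ n x, ‖τ n x‖ ≤ ‖x‖)
    (hD : Dense {f | LocSmall τ f}) : ∃ g, Dense (cyc τ g : Set X) := by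
  have : SecondCountableTopology X := UniformSpace.secondCountable_of_separable X
  let B := TopologicalSpace.countableBasis X
  let O : B → Set X := fun W =>
    ⋃ p ∈ {p : X →L[𝕜] X | ∀ x, p x ∈ cyc τ x}, p ⁻¹' (W : Set X)
  have hO : ∀ W, IsOpen (O W) := fun W => isOpen_biUnion fun p _ =>
    (TopologicalSpace.isOpen_of_mem_countableBasis W.2).preimage p.continuous
  have hOd : ∀ W, Dense (O W) := by
    intro W
    rw [Metric.dense_iff]
    intro u r hr
    obtain ⟨w, hw⟩ := TopologicalSpace.nonempty_of_mem_countableBasis W.2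
    obtain ⟨ε, hε, hball⟩ := Metric.isOpen_iff.1
      (TopologicalSpace.isOpen_of_mem_countableBasis W.2) w hw
    let α := ‖u‖ + ‖w‖ + 1
    have hα : 0 < α := by positivity
    obtain ⟨m, hm⟩ := exists_pow_lt_of_lt_one (show 0 < min r ε / α by positivity)
      (show (9 / 10 : ℝ) < 1 by norm_num)
    rw [lt_div_iff₀ hα] at hm
    obtain ⟨p, η, -, hp, h1, h2, h3⟩ := iter τ h0 hadd hn hD α hα u w
      (by simp only [α]; linarith [norm_nonneg w]) (by simp only [α]; linarith [norm_nonneg u]) m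
    refine ⟨u + η, ?_, ?_⟩
    · simpa using h2.trans_lt (hm.trans_le (min_le_left _ _))
    · refine Set.mem_biUnion (show p ∈ {p : X →L[𝕜] X | ∀ x, p x ∈ cyc τ x} from hp) ?_
      apply hball
      simpa [h3] using h1.trans_lt (hm.trans_le (min_le_right _ _))
  have : Countable B := (TopologicalSpace.countable_countableBasis X).to_subtype
  obtain ⟨g, hg⟩ := (dense_iInter_of_isOpen hO hOd).nonempty
  refine ⟨g, (TopologicalSpace.isBasis_countableBasis X).dense_iff.2 fun W hW _ => ?_⟩
  have := Set.mem_iInter.1 hg ⟨W, hW⟩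
  simp only [O, Set.mem_iUnion] at this
  obtain ⟨p, hp, hx⟩ := this
  exact ⟨p g, hx, hp g⟩

end Abstract

section Concrete
variable {𝕜 : Type*} [RCLike 𝕜]
open Filter Topology

theorem c0_norm_le {f : C₀(ℝ, 𝕜)} {C : ℝ} (hC : 0 ≤ C) (h : ∀ x, ‖f x‖ ≤ C) : ‖f‖ ≤ C := by
  rw [← ZeroAtInftyContinuousMap.norm_toBCF_eq_norm]
  exact (BoundedContinuousFunction.norm_le hC).2 h

theorem c0_apply_le (f : C₀(ℝ, 𝕜)) (x : ℝ) : ‖f x‖ ≤ ‖f‖ := by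
  rw [← ZeroAtInftyContinuousMap.norm_toBCF_eq_norm]
  exact f.toBCF.norm_coe_le_norm x

/-- translation on `C₀` -/
noncomputable def tr (t : ℝ) : C₀(ℝ, 𝕜) →L[𝕜] C₀(ℝ, 𝕜) :=
  LinearMap.mkContinuous
    (ZeroAtInftyContinuousMap.compLinearMap (Homeomorph.addRight t).toCocompactMap) 1 (by
      intro f
      rw [one_mul]
      exact c0_norm_le (norm_nonneg _) fun x => c0_apply_le f (x + t))

theorem tr_apply (t : ℝ) (f : C₀(ℝ, 𝕜)) (x : ℝ) : tr t f x = f (x + t) := rfl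

/-- translation on the power -/
noncomputable def trp (k : ℕ) (n : ℤ) : (Fin k → C₀(ℝ, 𝕜)) →L[𝕜] (Fin k → C₀(ℝ, 𝕜)) :=
  ContinuousLinearMap.pi fun i => (tr (n : ℝ)).comp (ContinuousLinearMap.proj i)

theorem trp_apply (k : ℕ) (n : ℤ) (f : Fin k → C₀(ℝ, 𝕜)) (i : Fin k) (x : ℝ) :
    trp k n f i x = f i (x + n) := rfl

theorem trp_norm (k : ℕ) (n : ℤ) (f : Fin k → C₀(ℝ, 𝕜)) : ‖trp k n f‖ ≤ ‖f‖ :=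
  (pi_norm_le_iff_of_nonneg (norm_nonneg _)).2 fun i => c0_norm_le (norm_nonneg _) fun x =>
    (c0_apply_le (f i) (x + n)).trans (norm_le_pi_norm f i)

theorem c0_sum_apply (s : Finset ℤ) (F : ℤ → C₀(ℝ, 𝕜)) (x : ℝ) :
    (∑ n ∈ s, F n) x = ∑ n ∈ s, F n x := by
  classical
  induction s using Finset.induction_on with
  | empty => simp
  | insert a s ha ih => rw [Finset.sum_insert ha, Finset.sum_insert ha,
      ZeroAtInftyContinuousMap.add_apply, ih]

theorem locSmall_of_support (k : ℕ) (f : Fin k → C₀(ℝ, 𝕜)) (R : ℝ)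
    (hf : ∀ i x, R < |x| → f i x = 0) : LocSmall (trp k) f := by
  obtain ⟨M0, hM0⟩ := exists_int_gt (2 * |R|)
  refine ⟨M0, fun M hM s a c hc ha => ?_⟩
  have hMR : 2 * |R| < (M : ℝ) := hM0.trans_le (by exact_mod_cast hM)
  refine (pi_norm_le_iff_of_nonneg (by positivity)).2 fun i => c0_norm_le (by positivity) fun x => ?_
  have e : (∑ n ∈ s, a n • trp k (M * n) f) i x = ∑ n ∈ s, a n * f i (x + M * n) := by
    rw [Finset.sum_apply, c0_sum_apply]
    refine Finset.sum_congr rfl fun n _ => ?_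
    rw [Pi.smul_apply, ZeroAtInftyContinuousMap.smul_apply, trp_apply]
    push_cast
    rfl
  rw [e]
  by_cases hex : ∃ m ∈ s, |x + M * (m : ℝ)| ≤ R
  · obtain ⟨m, hm, hmR⟩ := hex
    rw [Finset.sum_eq_single_of_mem m hm, norm_mul]
    · exact mul_le_mul (ha m) ((c0_apply_le _ _).trans (norm_le_pi_norm f i)) (norm_nonneg _) hc
    · intro n _ hnm
      rw [hf, mul_zero]
      by_contra! hcon
      have h1 : |(M : ℝ) * ((n : ℝ) - m)| ≤ 2 * |R| := by
        have : (M : ℝ) * ((n : ℝ) - m) = (x + M * n) - (x + M * m) := by ring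
        rw [this]
        have := abs_sub (x + M * (n : ℝ)) (x + M * (m : ℝ))
        linarith [le_abs_self R]
      have h2 : (1 : ℝ) ≤ |(n : ℝ) - m| := by
        have : 1 ≤ |n - m| := Int.one_le_abs (sub_ne_zero.2 hnm)
        exact_mod_cast this
      have hMpos : 0 < (M : ℝ) := lt_of_le_of_lt (by positivity) hMR
      rw [abs_mul, abs_of_pos hMpos] at h1
      nlinarith
  · push Not at hex
    rw [Finset.sum_eq_zero fun n hn => by rw [hf i _ (hex n hn), mul_zero], norm_zero]
    positivity

/-- cutoff function -/
noncomputable def chi (N : ℕ) (x : ℝ) : ℝ := max 0 (min 1 (N + 1 - |x|))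

theorem chi_cont (N : ℕ) : Continuous (chi N) := by unfold chi; fun_prop
theorem chi_nonneg (N : ℕ) (x : ℝ) : 0 ≤ chi N x := le_max_left _ _
theorem chi_le (N : ℕ) (x : ℝ) : chi N x ≤ 1 := max_le zero_le_one (min_le_left _ _)
theorem chi_one (N : ℕ) (x : ℝ) (h : |x| ≤ N) : chi N x = 1 := by
  unfold chi; rw [min_eq_left (by linarith), max_eq_right zero_le_one]
theorem chi_zero (N : ℕ) (x : ℝ) (h : (N : ℝ) + 1 < |x|) : chi N x = 0 := by
  unfold chi; exact max_eq_left ((min_le_right _ _).trans (by linarith))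

/-- cut off a continuous function -/
noncomputable def cut (N : ℕ) (f : C(ℝ, 𝕜)) : C₀(ℝ, 𝕜) where
  toFun x := (chi N x : 𝕜) * f x
  continuous_toFun := (RCLike.continuous_ofReal.comp (chi_cont N)).mul f.continuous
  zero_at_infty' := by
    refine tendsto_const_nhds.congr' ?_
    have : ∀ᶠ x : ℝ in cocompact ℝ, (N : ℝ) + 1 < ‖x‖ :=
      (tendsto_norm_cocompact_atTop (E := ℝ)).eventually_gt_atTop _
    filter_upwards [this] with x hx
    rw [chi_zero N x hx]; simp

theorem cut_apply (N : ℕ) (f : C(ℝ, 𝕜)) (x : ℝ) : cut N f x = (chi N x : 𝕜) * f x := rfl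

theorem cut_continuous (N : ℕ) : Continuous (cut (𝕜 := 𝕜) N) := by
  refine continuous_iff_continuousAt.2 fun f => ?_
  rw [ContinuousAt, ZeroAtInftyContinuousMap.tendsto_iff_tendstoUniformly,
    Metric.tendstoUniformly_iff]
  intro ε hε
  have h := ContinuousMap.tendsto_iff_forall_isCompact_tendstoUniformlyOn.1
    (tendsto_id (x := 𝓝 f)) (Metric.closedBall (0 : ℝ) (N + 1)) (isCompact_closedBall _ _)
  filter_upwards [Metric.tendstoUniformlyOn_iff.1 h ε hε] with g hg x
  rw [cut_apply, cut_apply, dist_eq_norm, ← mul_sub, norm_mul]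
  by_cases hx : (N : ℝ) + 1 < |x|
  · rw [chi_zero N x hx]; simpa using hε
  · have := hg x (by simpa using not_lt.1 hx)
    rw [dist_eq_norm] at this
    refine lt_of_le_of_lt ?_ this
    refine mul_le_of_le_one_left (norm_nonneg _) ?_
    rw [RCLike.norm_ofReal, abs_of_nonneg (chi_nonneg N x)]
    exact chi_le N x

theorem cut_tendsto (f : C₀(ℝ, 𝕜)) :
    Tendsto (fun N => cut N (f : C(ℝ, 𝕜))) atTop (𝓝 f) := by
  rw [ZeroAtInftyContinuousMap.tendsto_iff_tendstoUniformly, Metric.tendstoUniformly_iff]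
  intro ε hε
  have h1 : ∀ᶠ x in cocompact ℝ, ‖f x‖ < ε := by
    have := (zero_at_infty f).norm
    rw [norm_zero] at this
    exact this.eventually_lt_const hε
  rw [← Metric.cobounded_eq_cocompact, ← comap_norm_atTop, eventually_comap,
    eventually_atTop] at h1
  obtain ⟨r, hr⟩ := h1
  obtain ⟨N0, hN0⟩ := exists_nat_ge r
  filter_upwards [eventually_ge_atTop N0] with N hN x
  rw [cut_apply, dist_eq_norm]
  change ‖f x - (chi N x : 𝕜) * f x‖ < ε
  by_cases hx : |x| ≤ N
  · rw [chi_one N x hx]; simpa using hε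
  · push Not at hx
    have hNr : r ≤ N := hN0.trans (by exact_mod_cast hN)
    have h2 := hr ‖x‖ (hNr.trans hx.le) x rfl
    have e : f x - (chi N x : 𝕜) * f x = ((1 - chi N x : ℝ) : 𝕜) * f x := by push_cast; ring
    rw [e, norm_mul, RCLike.norm_ofReal, abs_of_nonneg (by linarith [chi_le N x])]
    exact (mul_le_of_le_one_left (norm_nonneg _) (by linarith [chi_nonneg N x])).trans_lt h2

theorem c0_separable : TopologicalSpace.SeparableSpace C₀(ℝ, 𝕜) := by
  have hc : Continuous fun p : ℕ × C(ℝ, 𝕜) => cut p.1 p.2 :=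
    continuous_prod_of_discrete_left.2 fun N => cut_continuous N
  have hd : DenseRange fun p : ℕ × C(ℝ, 𝕜) => cut p.1 p.2 := fun f =>
    mem_closure_of_tendsto (cut_tendsto f) (Eventually.of_forall fun N => ⟨(N, (f : C(ℝ, 𝕜))), rfl⟩)
  exact hd.separableSpace hc

theorem dense_locSmall (k : ℕ) :
    Dense {f : Fin k → C₀(ℝ, 𝕜) | LocSmall (trp k) f} := by
  intro f
  have ht : Tendsto (fun N : ℕ => fun i => cut N (f i : C(ℝ, 𝕜))) atTop (𝓝 f) :=
    tendsto_pi_nhds.2 fun i => cut_tendsto (f i)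
  refine mem_closure_of_tendsto ht (Eventually.of_forall fun N => ?_)
  refine locSmall_of_support k _ (N + 1) fun i x hx => ?_
  rw [cut_apply, chi_zero N x hx]; simp

theorem cyclic_main (𝕜 : Type*) [RCLike 𝕜] (k : ℕ) :
    ∃ g : Fin k → C₀(ℝ, 𝕜),
      Dense (Submodule.span 𝕜
        {h : Fin k → C₀(ℝ, 𝕜) | ∃ n : ℤ, ∀ (i : Fin k) (x : ℝ), h i x = g i (x + n)} :
        Set (Fin k → C₀(ℝ, 𝕜))) := by
  have := c0_separable (𝕜 := 𝕜)
  obtain ⟨g, hg⟩ := exists_cyclic (trp (𝕜 := 𝕜) k)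
    (fun f => by
      funext i; ext x; rw [trp_apply]; simp)
    (fun m n f => by
      funext i; ext x; rw [trp_apply, trp_apply, trp_apply]; push_cast; congr 1; ring)
    (trp_norm k) (dense_locSmall k)
  refine ⟨g, hg.mono ?_⟩
  refine Submodule.span_mono ?_
  rintro _ ⟨n, rfl⟩
  exact ⟨n, fun i x => trp_apply k n g i x⟩

end Concrete

/-- **Cyclicity of the translation operator on `C₀(ℝ)ᵏ` (after Atzmon–Olevskii).**
For every `k ≥ 1`, the operator `V : (f_i)_{1≤i≤k} ↦ (f_i(· + 1))_{1≤i≤k}` on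
`(C₀(ℝ, ℂ))ᵏ` is cyclic: there exists `g` such that the complex linear span of
`{Vⁿ g : n ∈ ℤ}` is dense.  The same holds over `ℝ` for `(C₀(ℝ, ℝ))ᵏ`. -/
theorem translation_cyclic_on_C0_pow
    (k : ℕ) (hk : 1 ≤ k) :
    (∃ g : Fin k → C₀(ℝ, ℂ),
      Dense (Submodule.span ℂ
        {h : Fin k → C₀(ℝ, ℂ) | ∃ n : ℤ, ∀ (i : Fin k) (x : ℝ), h i x = g i (x + n)} :
        Set (Fin k → C₀(ℝ, ℂ)))) ∧
    (∃ g : Fin k → C₀(ℝ, ℝ),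
      Dense (Submodule.span ℝ
        {h : Fin k → C₀(ℝ, ℝ) | ∃ n : ℤ, ∀ (i : Fin k) (x : ℝ), h i x = g i (x + n)} :
        Set (Fin k → C₀(ℝ, ℝ)))) := by
  exact ⟨cyclic_main ℂ k, cyclic_main ℝ k⟩
end
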